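/- Let H = 1/6, let (Ω,F,P) be a probability space, and let X¹, X² : ℝ → Ω → ℝ be two independent centered Gaussian processes, each with covariance C_{1/6}. Let f₁, f₂, f₃, f₄ ∈ C_b^∞(ℝ²) and fix t ≥ 0. Then for each i ∈ {1,2} there exists a constant C > 0, depending only on f₁,…,f₄ (not on n or t), such that sup_{n≥1} Σ_{i₁,i₂,i₃,i₄=0}^{⌊2^{n/2}t⌋−1} | E[ Π_{a=1}^{4} ( Δ_{i_a,n}f_a(X¹,X²) · ((Δⁱ_{i_a,n})³ − 3·2^{−n/3}·Δⁱ_{i_a,n}) ) ] | ≤ C(t + t² + t³ + t⁴). -/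

import Mathlib

open MeasureTheory ProbabilityTheory Filter

noncomputable section

/-- Covariance function of the (two-sided) fractional Brownian motion with Hurst index `H`:
`C_H(t,s) = (|t|^{2H} + |s|^{2H} − |t−s|^{2H})/2`. -/
def covH (H t s : ℝ) : ℝ :=
  (|t| ^ (2 * H) + |s| ^ (2 * H) - |t - s| ^ (2 * H)) / 2

/-- `ρ_H(k) = (1/2)(|k+1|^{2H} + |k−1|^{2H} − 2|k|^{2H})`. -/
def rhoH (H : ℝ) (k : ℤ) : ℝ :=
  (|(k : ℝ) + 1| ^ (2 * H) + |(k : ℝ) - 1| ^ (2 * H) - 2 * |(k : ℝ)| ^ (2 * H)) / 2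

/-- `X` is a centered Gaussian process with covariance function `C` under `P`: every finite
linear combination of values of the process is a centered real Gaussian random variable with
the appropriate variance. -/
def IsCenteredGaussianProcess {Ω : Type*} [MeasurableSpace Ω] (P : Measure Ω)
    (X : ℝ → Ω → ℝ) (C : ℝ → ℝ → ℝ) : Prop :=
  (∀ t, Measurable (X t)) ∧
  ∀ (m : ℕ) (ts : Fin m → ℝ) (c : Fin m → ℝ),
    Measure.map (fun ω => ∑ i, c i * X (ts i) ω) P =
      gaussianReal 0 (Real.toNNReal (∑ i, ∑ j, c i * c j * C (ts i) (ts j)))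

/-- The σ-algebras generated by the two processes `X1` and `X2` are independent under `P`. -/
def IndepProcesses {Ω : Type*} [MeasurableSpace Ω] (P : Measure Ω)
    (X1 X2 : ℝ → Ω → ℝ) : Prop :=
  ProbabilityTheory.Indep
    (⨆ t : ℝ, MeasurableSpace.comap (X1 t) inferInstance)
    (⨆ t : ℝ, MeasurableSpace.comap (X2 t) inferInstance) P

/-- `g` is infinitely differentiable and bounded together with all its derivatives. -/
def CbSmooth {E : Type*} [NormedAddCommGroup E] [NormedSpace ℝ E] (g : E → ℝ) : Prop :=
  (∀ n : ℕ, ContDiff ℝ n g) ∧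
  ∀ k : ℕ, ∃ M : ℝ, ∀ x : E, ‖iteratedFDeriv ℝ k g x‖ ≤ M

/-- `f : ℝ² → ℝ` (in curried form) belongs to `C_b^∞(ℝ²)`. -/
def CbSmooth2 (f : ℝ → ℝ → ℝ) : Prop :=
  CbSmooth fun p : ℝ × ℝ => f p.1 p.2

/-- Partial derivative of `f : ℝ → ℝ → ℝ`, taken `k` times in the first variable and `l` times
in the second variable. -/
def pd (k l : ℕ) (f : ℝ → ℝ → ℝ) (x y : ℝ) : ℝ :=
  iteratedDeriv k (fun u => iteratedDeriv l (fun v => f u v) y) x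

/-- The dyadic point `j·2^{−n/2}`. -/
def dyadicPt (n j : ℕ) : ℝ := (j : ℝ) * (2 : ℝ) ^ (-(n : ℝ) / 2)

/-- The number of dyadic steps `⌊2^{n/2} t⌋`. -/
def nSteps (n : ℕ) (t : ℝ) : ℕ := Nat.floor ((2 : ℝ) ^ ((n : ℝ) / 2) * t)

variable {Ω : Type*}

/-- The increment `X_{(j+1)2^{−n/2}} − X_{j2^{−n/2}}` of the process `X`. -/
def Xincr (X : ℝ → Ω → ℝ) (n j : ℕ) (ω : Ω) : ℝ :=
  X (dyadicPt n (j + 1)) ω - X (dyadicPt n j) ω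

/-- The midpoint evaluation `Δ_{j,n} g(X¹,X²)`. -/
def Xmid (X1 X2 : ℝ → Ω → ℝ) (g : ℝ → ℝ → ℝ) (n j : ℕ) (ω : Ω) : ℝ :=
  g ((X1 (dyadicPt n (j + 1)) ω + X1 (dyadicPt n j) ω) / 2)
    ((X2 (dyadicPt n (j + 1)) ω + X2 (dyadicPt n j) ω) / 2)

/-- Gaussian integration by parts on the real line. -/
lemma integral_id_mul_gaussianReal {v : NNReal} (hv : v ≠ 0) {φ φ' : ℝ → ℝ}
    (hφ : ∀ x, HasDerivAt φ (φ' x) x)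
    (h1 : Integrable (fun x => x * φ x) (gaussianReal 0 v))
    (h2 : Integrable φ (gaussianReal 0 v)) (h3 : Integrable φ' (gaussianReal 0 v)) :
    ∫ x, x * φ x ∂(gaussianReal 0 v) = v * ∫ x, φ' x ∂(gaussianReal 0 v) := by
  have hInt : ∀ f : ℝ → ℝ, Integrable f (gaussianReal 0 v) →
      Integrable (fun x => f x * gaussianPDFReal 0 v x) := by
    intro f hf
    rw [gaussianReal_of_var_ne_zero _ hv, integrable_withDensity_iff_integrable_smul'
      (measurable_gaussianPDF 0 v) (ae_of_all _ fun _ => gaussianPDF_lt_top)] at hf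
    refine hf.congr (ae_of_all _ fun x => ?_)
    simp [toReal_gaussianPDF, mul_comm]
  have hv' : (v : ℝ) ≠ 0 := by exact_mod_cast hv
  have hpdf : ∀ x, HasDerivAt (gaussianPDFReal 0 v) (-(x / v) * gaussianPDFReal 0 v x) x := by
    intro x
    have h : HasDerivAt (fun x : ℝ => -(x - 0) ^ 2 / (2 * (v : ℝ))) (-(x / v)) x := by
      have := ((((hasDerivAt_id x).sub_const 0).pow 2).neg).div_const (2 * (v : ℝ))
      refine this.congr_deriv ?_
      simp
      field_simp
    have h' := (h.exp).const_mul (√(2 * Real.pi * v))⁻¹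
    rw [gaussianPDFReal_def]
    refine h'.congr_deriv ?_
    ring
  have key := integral_mul_deriv_eq_deriv_mul_of_integrable (u := φ) (u' := φ')
    (v := gaussianPDFReal 0 v) (v' := fun x => -(x / v) * gaussianPDFReal 0 v x)
    (fun x _ => hφ x) (fun x _ => hpdf x)
    (((hInt _ h1).const_mul (-(v : ℝ)⁻¹)).congr (ae_of_all _ fun x => by
      simp only [Pi.mul_apply]; ring))
    (hInt _ h3) (hInt _ h2)
  rw [integral_gaussianReal_eq_integral_smul hv, integral_gaussianReal_eq_integral_smul hv]
  simp only [smul_eq_mul]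
  have e1 : ∫ x, gaussianPDFReal 0 v x * (x * φ x)
      = -v * ∫ x, φ x * (-(x / v) * gaussianPDFReal 0 v x) := by
    rw [← integral_const_mul]
    congr 1; ext x; field_simp
  rw [e1, key]
  simp only [neg_mul_neg, mul_comm]

/-- Gaussian integration by parts with an independent parameter. -/
lemma integral_mul_eq_of_indepFun {Ω E : Type*} [MeasurableSpace Ω] [MeasurableSpace E]
    {P : Measure Ω} [IsProbabilityMeasure P] {v : NNReal} (hv : v ≠ 0) {U : Ω → ℝ} {W : Ω → E}
    (hU : Measurable U) (hW : Measurable W) (hlaw : P.map U = gaussianReal 0 v)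
    (hind : IndepFun U W P) {Φ Φ' : ℝ → E → ℝ}
    (mΦ : Measurable (Function.uncurry Φ)) (mΦ' : Measurable (Function.uncurry Φ'))
    (hd : ∀ w x, HasDerivAt (fun x => Φ x w) (Φ' x w) x)
    (h1 : Integrable (fun ω => U ω * Φ (U ω) (W ω)) P)
    (h2 : Integrable (fun ω => Φ (U ω) (W ω)) P)
    (h3 : Integrable (fun ω => Φ' (U ω) (W ω)) P) :
    ∫ ω, U ω * Φ (U ω) (W ω) ∂P = v * ∫ ω, Φ' (U ω) (W ω) ∂P := by
  have hUW : Measurable fun ω => (U ω, W ω) := hU.prodMk hW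
  have hprod : P.map (fun ω => (U ω, W ω)) = (gaussianReal 0 v).prod (P.map W) := by
    rw [← hlaw]
    exact (indepFun_iff_map_prod_eq_prod_map_map hU.aemeasurable hW.aemeasurable).1 hind
  have : IsProbabilityMeasure (P.map W) := Measure.isProbabilityMeasure_map hW.aemeasurable
  have mΨ : Measurable fun p : ℝ × E => p.1 * Φ p.1 p.2 := measurable_fst.mul mΦ
  have tr : ∀ F : ℝ × E → ℝ, Measurable F → Integrable (fun ω => F (U ω, W ω)) P →
      Integrable F ((gaussianReal 0 v).prod (P.map W)) ∧
      ∫ ω, F (U ω, W ω) ∂P = ∫ w, ∫ x, F (x, w) ∂(gaussianReal 0 v) ∂(P.map W) := by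
    intro F hF hi
    have hi' : Integrable F ((gaussianReal 0 v).prod (P.map W)) := by
      rw [← hprod]
      exact (integrable_map_measure hF.aestronglyMeasurable hUW.aemeasurable).2 hi
    refine ⟨hi', ?_⟩
    rw [← integral_prod_symm _ hi', ← hprod,
      integral_map hUW.aemeasurable hF.aestronglyMeasurable]
  obtain ⟨i1, e1⟩ := tr _ mΨ h1
  obtain ⟨i2, -⟩ := tr _ mΦ h2
  obtain ⟨i3, e3⟩ := tr _ mΦ' h3
  simp only [Function.uncurry] at e3
  rw [e1, e3, ← integral_const_mul]
  refine integral_congr_ae ?_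
  filter_upwards [i1.prod_left_ae, i2.prod_left_ae, i3.prod_left_ae] with w a1 a2 a3
  exact integral_id_mul_gaussianReal hv (hd w) a1 a2 a3

/-- Multivariate Gaussian integration by parts: if `V` is a centered Gaussian vector independent of
`Z`, then `E[V_u F(V, Z)]` is the expectation of the derivative of `F` in the direction of the
covariances with `V_u`. -/
lemma integral_eval_mul_eq_integral_deriv {Ω E T : Type*} [MeasurableSpace Ω] [MeasurableSpace E]
    [Fintype T] {P : Measure Ω} [IsProbabilityMeasure P] {V : T → Ω → ℝ} {Z : Ω → E}
    (hG : IsGaussianProcess V P) (mV : ∀ s, Measurable (V s)) (h0 : ∀ s, ∫ ω, V s ω ∂P = 0)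
    (mZ : Measurable Z) (hind : IndepFun (fun ω s => V s ω) Z P) (u : T)
    (hv : 0 < Var[V u; P]) {F F' : (T → ℝ) → E → ℝ}
    (mF : Measurable (Function.uncurry F)) (mF' : Measurable (Function.uncurry F'))
    (hd : ∀ w y, HasDerivAt (fun x : ℝ => F (w + x • fun s => cov[V u, V s; P]) y) (F' w y) 0)
    (h1 : Integrable (fun ω => V u ω * F (fun s => V s ω) (Z ω)) P)
    (h2 : Integrable (fun ω => F (fun s => V s ω) (Z ω)) P)
    (h3 : Integrable (fun ω => F' (fun s => V s ω) (Z ω)) P) :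
    ∫ ω, V u ω * F (fun s => V s ω) (Z ω) ∂P = ∫ ω, F' (fun s => V s ω) (Z ω) ∂P := by
  set c : T → ℝ := fun s => cov[V u, V s; P] with hc
  set v : NNReal := Var[V u; P].toNNReal with hvdef
  have hvv : (v : ℝ) = Var[V u; P] := Real.coe_toNNReal _ hv.le
  have hv0 : v ≠ 0 := by
    intro h; rw [h] at hvv; simp only [NNReal.coe_zero] at hvv; linarith
  have hv0' : (v : ℝ) ≠ 0 := by exact_mod_cast hv0
  have hlaw : P.map (V u) = gaussianReal 0 v := by
    rw [(hG.hasGaussianLaw_eval u).map_eq_gaussianReal, h0]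
  have hL2 : ∀ s, MemLp (V s) 2 P := fun s => (hG.hasGaussianLaw_eval s).memLp_two
  let Vp : T → Ω → ℝ := fun s ω => V s ω - (c s / v) * V u ω
  have mVp : ∀ s, Measurable (Vp s) := fun s => (mV s).sub ((mV u).const_mul _)
  have hjoint : IsGaussianProcess (Sum.elim (fun _ : Unit => V u) Vp) P := by
    classical
    refine hG.of_isGaussianProcess fun s => ?_
    rcases s with _ | s
    · exact ⟨{u}, .proj ⟨u, by simp⟩, fun ω => by simp⟩
    · refine ⟨{u, s}, .proj ⟨s, by simp⟩ - (c s / v) • .proj ⟨u, by simp⟩, fun ω => ?_⟩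
      simp [Vp]
  have hUV : IndepFun (V u) (fun ω s => Vp s ω) P := by
    have h := hjoint.indepFun_of_covariance_eq_zero (fun _ => (mV u).aemeasurable)
      (fun s => (mVp s).aemeasurable) (fun _ s => by
        have : Vp s = V s - fun ω => (c s / v) * V u ω := rfl
        rw [this, covariance_sub_right (hL2 u) (hL2 s) ((hL2 u).const_mul _),
          covariance_const_mul_right, covariance_self (mV u).aemeasurable, ← hvv, hc]
        field_simp
        simp)
    exact h.comp (φ := fun f : Unit → ℝ => f ()) (ψ := id) (by fun_prop) measurable_id
  have mVp' : Measurable fun ω s => Vp s ω := measurable_pi_lambda _ mVp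
  have hUVZ : IndepFun (V u) (fun ω => ((fun s => Vp s ω), Z ω)) P := by
    have hpair : IndepFun (fun ω => (V u ω, fun s => Vp s ω)) Z P :=
      hind.comp (φ := fun f : T → ℝ => (f u, fun s => f s - (c s / v) * f u)) (ψ := id)
        (by fun_prop) measurable_id
    rw [indepFun_iff_map_prod_eq_prod_map_map (mV u).aemeasurable
      (mVp'.prodMk mZ).aemeasurable]
    have e1 := (indepFun_iff_map_prod_eq_prod_map_map
      ((mV u).prodMk mVp').aemeasurable mZ.aemeasurable).1 hpair
    have e2 := (indepFun_iff_map_prod_eq_prod_map_map (mV u).aemeasurable mVp'.aemeasurable).1 hUV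
    have e3 := (indepFun_iff_map_prod_eq_prod_map_map mVp'.aemeasurable mZ.aemeasurable).1
      (hpair.comp (φ := Prod.snd) (ψ := id) measurable_snd measurable_id)
    have i1 : IsProbabilityMeasure (P.map (V u)) :=
      Measure.isProbabilityMeasure_map (mV u).aemeasurable
    have i2 : IsProbabilityMeasure (P.map fun ω s => Vp s ω) :=
      Measure.isProbabilityMeasure_map mVp'.aemeasurable
    have i3 : IsProbabilityMeasure (P.map Z) := Measure.isProbabilityMeasure_map mZ.aemeasurable
    have e3' : P.map (fun ω => ((fun s => Vp s ω), Z ω))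
        = (P.map fun ω s => Vp s ω).prod (P.map Z) := e3
    rw [e3', ← Measure.prodAssoc_prod, ← e2, ← e1, Measure.map_map (by fun_prop)
      (((mV u).prodMk mVp').prodMk mZ)]
    rfl
  have hrec : ∀ ω, (fun s => Vp s ω) + (V u ω / v) • c = fun s => V s ω := by
    intro ω; ext s; simp [Vp]; ring
  have mA : Measurable fun p : ℝ × ((T → ℝ) × E) => (p.2.1 + (p.1 / v) • c, p.2.2) := by
    fun_prop
  have key := integral_mul_eq_of_indepFun hv0 (mV u) (mVp'.prodMk mZ) hlaw hUVZ
    (Φ := fun x p => F (p.1 + (x / v) • c) p.2)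
    (Φ' := fun x p => F' (p.1 + (x / v) • c) p.2 * (v : ℝ)⁻¹)
    (mF.comp mA) ((mF'.comp mA).mul_const _)
    (fun p x => by
      have h := hd (p.1 + (x / v) • c) p.2
      have h' : HasDerivAt (fun y : ℝ => y / v - x / v) ((v : ℝ)⁻¹) x := by
        simpa using ((hasDerivAt_id x).div_const (v : ℝ)).sub_const (x / v)
      have h'' := HasDerivAt.comp x (by simpa using h) h'
      refine h''.congr_of_eventuallyEq (Eventually.of_forall fun y => ?_)
      simp only [Function.comp, add_assoc, ← add_smul, add_sub_cancel])
    (by simpa only [hrec] using h1) (by simpa only [hrec] using h2)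
    (by simpa only [hrec] using h3.mul_const _)
  simp only [hrec] at key
  rw [key, integral_mul_const]
  field_simp

/-- The product of the `d a`-th functions of the sequences `G a`, evaluated at the points
`(w (inr a), y a)`, and of the powers `w (inl a) ^ k a`. -/
def mixedMonomial (G : Fin 4 → ℕ → ℝ → ℝ → ℝ) (k d : Fin 4 → ℕ) (w : Fin 4 ⊕ Fin 4 → ℝ)
    (y : Fin 4 → ℝ) : ℝ :=
  ∏ a, (G a (d a) (w (.inr a)) (y a) * w (.inl a) ^ k a)

/-- `G a` is a sequence of bounded measurable functions, each the derivative of the previous one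
with respect to its first argument. -/
structure IsDerivSeq (G : Fin 4 → ℕ → ℝ → ℝ → ℝ) (M : ℕ → ℝ) : Prop where
  measurable : ∀ a d, Measurable (Function.uncurry (G a d))
  hasDerivAt : ∀ a d x y, HasDerivAt (fun x => G a d x y) (G a (d + 1) x y) x
  bound : ∀ a d x y, |G a d x y| ≤ M d
  mono : Monotone M

/-- `(δ, m)` is a nondegenerate centered Gaussian vector independent of `z`. -/
structure IsGaussianSetup {Ω : Type*} [MeasurableSpace Ω] (P : Measure Ω)
    (δ m z : Fin 4 → Ω → ℝ) : Prop where
  gaussian : IsGaussianProcess (Sum.elim δ m) P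
  measurable : ∀ s, Measurable (Sum.elim δ m s)
  measurable_param : ∀ a, Measurable (z a)
  mean : ∀ s, ∫ ω, Sum.elim δ m s ω ∂P = 0
  var_pos : ∀ a, 0 < Var[δ a; P]
  indep : IndepFun (fun ω s => Sum.elim δ m s ω) (fun ω a => z a ω) P

lemma measurable_mixedMonomial {G : Fin 4 → ℕ → ℝ → ℝ → ℝ} {M : ℕ → ℝ} (hG : IsDerivSeq G M)
    (k d : Fin 4 → ℕ) : Measurable (Function.uncurry (mixedMonomial G k d)) := by
  unfold mixedMonomial Function.uncurry
  refine Finset.measurable_prod _ fun a _ => Measurable.mul ?_ (by fun_prop)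
  exact (hG.measurable a (d a)).comp
    (g := Function.uncurry (G a (d a))) (f := fun p : (Fin 4 ⊕ Fin 4 → ℝ) × (Fin 4 → ℝ) =>
      (p.1 (.inr a), p.2 a)) (by fun_prop)

lemma IsDerivSeq.nonneg {G : Fin 4 → ℕ → ℝ → ℝ → ℝ} {M : ℕ → ℝ} (hG : IsDerivSeq G M) (d : ℕ) :
    0 ≤ M d := (abs_nonneg _).trans (hG.bound 0 d 0 0)

lemma integrable_mixedMonomial {Ω : Type*} [MeasurableSpace Ω] {P : Measure Ω}
    [IsProbabilityMeasure P] {δ m z : Fin 4 → Ω → ℝ} (hS : IsGaussianSetup P δ m z)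
    {G : Fin 4 → ℕ → ℝ → ℝ → ℝ} {M : ℕ → ℝ} (hG : IsDerivSeq G M) (k d : Fin 4 → ℕ) :
    Integrable (fun ω => mixedMonomial G k d (fun s => Sum.elim δ m s ω) (fun a => z a ω)) P := by
  have hlaw : HasGaussianLaw (fun ω s => Sum.elim δ m s ω) P := by
    let L : (↥(Finset.univ : Finset (Fin 4 ⊕ Fin 4)) → ℝ) →L[ℝ] (Fin 4 ⊕ Fin 4 → ℝ) :=
      ContinuousLinearMap.pi fun s => .proj ⟨s, Finset.mem_univ s⟩
    exact (hS.gaussian.hasGaussianLaw Finset.univ).map L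
  have hp : Integrable (fun ω => ‖fun s => Sum.elim δ m s ω‖ ^ (∑ a, k a)) P := by
    have := hlaw.memLp (p := ((∑ a, k a : ℕ) : ENNReal)) (by simp)
    exact this.integrable_norm_pow'
  have mV : Measurable fun ω s => Sum.elim δ m s ω := measurable_pi_lambda _ hS.measurable
  have mz : Measurable fun ω a => z a ω := measurable_pi_lambda _ hS.measurable_param
  refine (hp.const_mul (∏ a, M (d a))).mono'
    ((measurable_mixedMonomial hG k d).comp (mV.prodMk mz)).aestronglyMeasurable
    (ae_of_all _ fun ω => ?_)
  rw [mixedMonomial, Real.norm_eq_abs, Finset.abs_prod, ← Finset.prod_pow_eq_pow_sum,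
    ← Finset.prod_mul_distrib]
  refine Finset.prod_le_prod (fun _ _ => abs_nonneg _) fun a _ => ?_
  rw [abs_mul, abs_pow]
  have h := norm_le_pi_norm (fun s => Sum.elim δ m s ω) (Sum.inl a)
  rw [Real.norm_eq_abs] at h
  gcongr
  · exact hG.nonneg _
  · exact hG.bound _ _ _ _

lemma hasDerivAt_mixedMonomial {G : Fin 4 → ℕ → ℝ → ℝ → ℝ} {M : ℕ → ℝ} (hG : IsDerivSeq G M)
    (k d : Fin 4 → ℕ) (w c : Fin 4 ⊕ Fin 4 → ℝ) (y : Fin 4 → ℝ) :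
    HasDerivAt (fun x : ℝ => mixedMonomial G k d (w + x • c) y)
      (∑ v, (c (.inr v) * mixedMonomial G k (d + Pi.single v 1) w y +
        c (.inl v) * k v * mixedMonomial G (k - Pi.single v 1) d w y)) 0 := by
  have h1 : ∀ s, HasDerivAt (fun x : ℝ => (w + x • c) s) (c s) 0 := by
    intro s
    simpa using ((hasDerivAt_id (0 : ℝ)).mul_const (c s)).const_add (w s)
  have h2 : ∀ v, HasDerivAt (fun x : ℝ => G v (d v) ((w + x • c) (.inr v)) (y v) *
      (w + x • c) (.inl v) ^ k v)
      (G v (d v + 1) (w (.inr v)) (y v) * c (.inr v) * w (.inl v) ^ k v +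
        G v (d v) (w (.inr v)) (y v) * (k v * w (.inl v) ^ (k v - 1) * c (.inl v))) 0 := by
    intro v
    have e := HasDerivAt.comp (h := fun x : ℝ => (w + x • c) (.inr v)) (0 : ℝ)
      (hG.hasDerivAt v (d v) ((w + (0 : ℝ) • c) (.inr v)) (y v)) (h1 (.inr v))
    refine (e.mul ((h1 (.inl v)).pow (k v))).congr_deriv ?_
    simp
  have h3 := HasDerivAt.fun_finsetProd (u := Finset.univ) (fun v _ => h2 v)
  refine h3.congr_deriv ?_
  refine Finset.sum_congr rfl fun v _ => ?_
  have e1 : mixedMonomial G k (d + Pi.single v 1) w y =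
      (∏ a ∈ Finset.univ.erase v, (G a (d a) (w (.inr a)) (y a) * w (.inl a) ^ k a)) *
        (G v (d v + 1) (w (.inr v)) (y v) * w (.inl v) ^ k v) := by
    rw [mixedMonomial, ← Finset.prod_erase_mul _ _ (Finset.mem_univ v)]
    congr 1
    · refine Finset.prod_congr rfl fun a ha => ?_
      simp [Pi.single_eq_of_ne (Finset.ne_of_mem_erase ha)]
    · simp
  have e2 : mixedMonomial G (k - Pi.single v 1) d w y =
      (∏ a ∈ Finset.univ.erase v, (G a (d a) (w (.inr a)) (y a) * w (.inl a) ^ k a)) *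
        (G v (d v) (w (.inr v)) (y v) * w (.inl v) ^ (k v - 1)) := by
    rw [mixedMonomial, ← Finset.prod_erase_mul _ _ (Finset.mem_univ v)]
    congr 1
    · refine Finset.prod_congr rfl fun a ha => ?_
      simp [Pi.single_eq_of_ne (Finset.ne_of_mem_erase ha)]
    · simp
  rw [e1, e2]
  simp only [zero_smul, add_zero, smul_eq_mul]
  ring

/-- The expectation of `mixedMonomial`. -/
def mixedMoment {Ω : Type*} [MeasurableSpace Ω] (P : Measure Ω)
    (δ m z : Fin 4 → Ω → ℝ) (G : Fin 4 → ℕ → ℝ → ℝ → ℝ) (k d : Fin 4 → ℕ) : ℝ :=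
  ∫ ω, mixedMonomial G k d (fun s => Sum.elim δ m s ω) (fun a => z a ω) ∂P

/-- One step of integration by parts. -/
lemma mixedMoment_add_single {Ω : Type*} [MeasurableSpace Ω] {P : Measure Ω}
    [IsProbabilityMeasure P] {δ m z : Fin 4 → Ω → ℝ} (hS : IsGaussianSetup P δ m z)
    {G : Fin 4 → ℕ → ℝ → ℝ → ℝ} {M : ℕ → ℝ} (hG : IsDerivSeq G M) (k d : Fin 4 → ℕ) (u : Fin 4) :
    mixedMoment P δ m z G (k + Pi.single u 1) d =
      ∑ v, (cov[δ u, m v; P] * mixedMoment P δ m z G k (d + Pi.single v 1) +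
        cov[δ u, δ v; P] * k v * mixedMoment P δ m z G (k - Pi.single v 1) d) := by
  have hmul : ∀ w y, mixedMonomial G (k + Pi.single u 1) d w y =
      w (.inl u) * mixedMonomial G k d w y := by
    intro w y
    rw [mixedMonomial, mixedMonomial, ← Finset.mul_prod_erase _ _ (Finset.mem_univ u),
      ← Finset.mul_prod_erase (a := u) _ _ (Finset.mem_univ u)]
    rw [Finset.prod_congr rfl (g := fun a => G a (d a) (w (.inr a)) (y a) * w (.inl a) ^ k a)
      fun a ha => by simp [Pi.single_eq_of_ne (Finset.ne_of_mem_erase ha)]]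
    simp only [Pi.add_apply, Pi.single_eq_same, pow_succ]
    ring
  have hInt := fun k d => integrable_mixedMonomial hS hG k d
  have hterm : ∀ v, Integrable (fun ω =>
      cov[δ u, m v; P] * mixedMonomial G k (d + Pi.single v 1)
        (fun s => Sum.elim δ m s ω) (fun a => z a ω) +
      cov[δ u, δ v; P] * k v * mixedMonomial G (k - Pi.single v 1) d
        (fun s => Sum.elim δ m s ω) (fun a => z a ω)) P :=
    fun v => ((hInt _ _).const_mul _).add ((hInt _ _).const_mul _)
  have key := integral_eval_mul_eq_integral_deriv hS.gaussian hS.measurable hS.mean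
    (Z := fun ω a => z a ω) (measurable_pi_lambda _ hS.measurable_param) hS.indep (.inl u)
    (hS.var_pos u) (F := mixedMonomial G k d)
    (F' := fun w y => ∑ v, (cov[δ u, m v; P] * mixedMonomial G k (d + Pi.single v 1) w y +
        cov[δ u, δ v; P] * k v * mixedMonomial G (k - Pi.single v 1) d w y))
    (measurable_mixedMonomial hG k d)
    (by
      unfold Function.uncurry
      exact Finset.measurable_sum _ fun v _ =>
        ((measurable_mixedMonomial hG k (d + Pi.single v 1)).const_mul _).add
          ((measurable_mixedMonomial hG (k - Pi.single v 1) d).const_mul _))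
    (fun w y => hasDerivAt_mixedMonomial hG k d w _ y)
    ((hInt (k + Pi.single u 1) d).congr (ae_of_all _ fun ω => hmul _ _))
    (hInt k d)
    (integrable_finsetSum _ fun v _ => hterm v)
  simp only [mixedMoment, hmul]
  refine key.trans ?_
  rw [integral_finsetSum _ fun v _ => hterm v]
  refine Finset.sum_congr rfl fun v _ => ?_
  rw [integral_add ((hInt _ _).const_mul _) ((hInt _ _).const_mul _), integral_const_mul,
    integral_const_mul]

/-- A contraction: `inl (u, v)` pairs the `u`-th increment with the argument of the `v`-th function,
`inr (u, v)` pairs the `u`-th and `v`-th increments. -/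
abbrev Contraction : Type := (Fin 4 × Fin 4) ⊕ (Fin 4 × Fin 4)

/-- How often each increment takes part in a contraction. -/
def Contraction.deg : Contraction → Fin 4 → ℕ
  | .inl p => Pi.single p.1 1
  | .inr p => Pi.single p.1 1 + Pi.single p.2 1

lemma mixedMoment_bound {Ω : Type*} [MeasurableSpace Ω] {P : Measure Ω}
    [IsProbabilityMeasure P] {δ m z : Fin 4 → Ω → ℝ} (hS : IsGaussianSetup P δ m z)
    {G : Fin 4 → ℕ → ℝ → ℝ → ℝ} {M : ℕ → ℝ} (hG : IsDerivSeq G M) {w : Contraction → ℝ}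
    (hw1 : ∀ u v, |cov[δ u, m v; P]| ≤ w (.inl (u, v)))
    (hw2 : ∀ u v, |cov[δ u, δ v; P]| ≤ w (.inr (u, v))) (D : ℕ) {B : ℝ} (hB : 0 ≤ B)
    (N : ℕ) : ∀ (k d : Fin 4 → ℕ) (s : ℝ), ∑ a, k a = N → (∀ b, d b + N ≤ D) → 0 ≤ s →
      (∀ L : List Contraction, (L.map Contraction.deg).sum = k → s * (L.map w).prod ≤ B) →
      s * |mixedMoment P δ m z G k d| ≤ (4 + D) ^ N * (M D ^ 4 * B) := by
  have hM : 0 ≤ M D := hG.nonneg D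
  have hK : (1 : ℝ) ≤ 4 + D := by
    have : (0 : ℝ) ≤ D := Nat.cast_nonneg D
    linarith
  induction N using Nat.strong_induction_on with
  | _ N ih =>
  intro k d s hk hd hs hL
  rcases Nat.eq_zero_or_pos N with rfl | hN
  · have hk0 : k = 0 := by
      ext a; exact (Finset.sum_eq_zero_iff.1 hk) a (Finset.mem_univ a)
    have hsB : s ≤ B := by simpa using hL [] (by simp [hk0])
    have hT : |mixedMoment P δ m z G k d| ≤ M D ^ 4 := by
      have h := norm_integral_le_of_norm_le_const (μ := P) (C := M D ^ 4)
        (f := fun ω => mixedMonomial G k d (fun s => Sum.elim δ m s ω) (fun a => z a ω))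
        (ae_of_all _ fun ω => by
          rw [mixedMonomial, Real.norm_eq_abs, Finset.abs_prod]
          refine (Finset.prod_le_prod (g := fun _ => M D) (fun _ _ => abs_nonneg _)
            fun a _ => ?_).trans_eq (by simp)
          simp only [hk0, Pi.zero_apply, pow_zero, mul_one]
          exact (hG.bound _ _ _ _).trans (hG.mono (by simpa using hd a)))
      simpa [mixedMoment] using h
    calc s * |mixedMoment P δ m z G k d| ≤ B * M D ^ 4 := by gcongr
      _ = _ := by ring
  · obtain ⟨u, hu⟩ : ∃ u, 0 < k u := by
      by_contra! h
      have : ∑ a, k a = 0 := Finset.sum_eq_zero fun a _ => Nat.le_zero.1 (h a)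
      omega
    set k' := k - Pi.single u 1 with hk'
    have hkk : k = k' + Pi.single u 1 := by
      ext a
      rcases eq_or_ne a u with rfl | h
      · simp [hk']; omega
      · simp [hk', Pi.single_eq_of_ne h]
    have hsum : ∑ a, k' a + 1 = N := by
      rw [← hk, hkk]; simp [Finset.sum_add_distrib]
    have harrow : ∀ v, s * |cov[δ u, m v; P] * mixedMoment P δ m z G k' (d + Pi.single v 1)| ≤
        (4 + D) ^ (N - 1) * (M D ^ 4 * B) := by
      intro v
      have hw : 0 ≤ w (.inl (u, v)) := (abs_nonneg _).trans (hw1 u v)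
      have h := ih (N - 1) (by omega) k' (d + Pi.single v 1) (s * w (.inl (u, v))) (by omega)
        (fun b => by
          have := hd b
          have h1 : (Pi.single v 1 : Fin 4 → ℕ) b ≤ 1 := by
            rw [Pi.single_apply]; split_ifs <;> simp
          simp only [Pi.add_apply]; omega)
        (by positivity)
        (fun L hLk => by
          have := hL (.inl (u, v) :: L) (by
            rw [List.map_cons, List.sum_cons, hLk, hkk, add_comm]; rfl)
          rwa [List.map_cons, List.prod_cons, ← mul_assoc] at this)
      refine le_trans ?_ h
      rw [abs_mul, mul_assoc]
      gcongr
      exact hw1 u v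
    have hpair : ∀ v, s * |cov[δ u, δ v; P] * k' v * mixedMoment P δ m z G (k' - Pi.single v 1) d|
        ≤ k' v * ((4 + D) ^ (N - 1) * (M D ^ 4 * B)) := by
      intro v
      rcases Nat.eq_zero_or_pos (k' v) with h0 | hpos
      · simp [h0]
      have hw : 0 ≤ w (.inr (u, v)) := (abs_nonneg _).trans (hw2 u v)
      have hkk' : k' - Pi.single v 1 + Pi.single v 1 = k' := by
        ext a
        rcases eq_or_ne a v with rfl | h
        · simp; omega
        · simp [Pi.single_eq_of_ne h]
      have hsum' : ∑ a, (k' - Pi.single v 1 : Fin 4 → ℕ) a + 1 = ∑ a, k' a := by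
        conv_rhs => rw [← hkk']
        simp [Finset.sum_add_distrib]
      have h := ih (N - 2) (by omega) (k' - Pi.single v 1) d (s * w (.inr (u, v))) (by omega)
        (fun b => by have := hd b; omega)
        (by positivity)
        (fun L hLk => by
          have := hL (.inr (u, v) :: L) (by
            rw [List.map_cons, List.sum_cons, hLk, hkk]
            conv_rhs => rw [← hkk']
            simp only [Contraction.deg]
            ac_rfl)
          rwa [List.map_cons, List.prod_cons, ← mul_assoc] at this)
      have h2 : ((4 : ℝ) + D) ^ (N - 2) ≤ (4 + D) ^ (N - 1) := pow_le_pow_right₀ hK (by omega)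
      calc s * |cov[δ u, δ v; P] * k' v * mixedMoment P δ m z G (k' - Pi.single v 1) d|
          = k' v * (s * |cov[δ u, δ v; P]| * |mixedMoment P δ m z G (k' - Pi.single v 1) d|) := by
            rw [abs_mul, abs_mul, Nat.abs_cast]; ring
        _ ≤ k' v * (s * w (.inr (u, v)) * |mixedMoment P δ m z G (k' - Pi.single v 1) d|) := by
            gcongr; exact hw2 u v
        _ ≤ k' v * ((4 + D) ^ (N - 2) * (M D ^ 4 * B)) := by gcongr
        _ ≤ _ := by gcongr
    have hsumR : ∑ v, (k' v : ℝ) ≤ D := by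
      rw [← Nat.cast_sum]
      have := hd 0
      exact_mod_cast (by omega : ∑ a, k' a ≤ D)
    rw [hkk, mixedMoment_add_single hS hG]
    calc s * |∑ v, (cov[δ u, m v; P] * mixedMoment P δ m z G k' (d + Pi.single v 1) +
            cov[δ u, δ v; P] * k' v * mixedMoment P δ m z G (k' - Pi.single v 1) d)|
        ≤ s * ∑ v, (|cov[δ u, m v; P] * mixedMoment P δ m z G k' (d + Pi.single v 1)| +
            |cov[δ u, δ v; P] * k' v * mixedMoment P δ m z G (k' - Pi.single v 1) d|) := by
          gcongr
          exact (Finset.abs_sum_le_sum_abs _ _).trans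
            (Finset.sum_le_sum fun v _ => abs_add_le _ _)
      _ = ∑ v, (s * |cov[δ u, m v; P] * mixedMoment P δ m z G k' (d + Pi.single v 1)| +
            s * |cov[δ u, δ v; P] * k' v * mixedMoment P δ m z G (k' - Pi.single v 1) d|) := by
          rw [Finset.mul_sum]; simp only [mul_add]
      _ ≤ ∑ v, ((4 + D) ^ (N - 1) * (M D ^ 4 * B) +
            k' v * ((4 + D) ^ (N - 1) * (M D ^ 4 * B))) :=
          Finset.sum_le_sum fun v _ => add_le_add (harrow v) (hpair v)
      _ = (4 + ∑ v, (k' v : ℝ)) * ((4 + D) ^ (N - 1) * (M D ^ 4 * B)) := by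
          rw [Finset.sum_add_distrib, add_mul, Finset.sum_mul]; simp
      _ ≤ (4 + D) * ((4 + D) ^ (N - 1) * (M D ^ 4 * B)) := by gcongr
      _ = (4 + D) ^ N * (M D ^ 4 * B) := by
          rw [← mul_assoc, ← pow_succ']
          congr 3; omega

namespace Contraction

/-- The power of the step deviation attached to a contraction. -/
def order : Contraction → ℕ
  | .inl _ => 3
  | .inr _ => 2

/-- The increments taking part in a contraction. -/
def src : Contraction → Finset (Fin 4)
  | .inl p => {p.1}
  | .inr p => {p.1, p.2}

/-- The indices on which the weight of a contraction depends. -/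
def verts : Contraction → Finset (Fin 4)
  | .inl p => {p.1, p.2}
  | .inr p => {p.1, p.2}

/-- A contraction which does not pair an increment with itself. -/
def Proper : Contraction → Prop
  | .inl _ => True
  | .inr p => p.1 ≠ p.2

/-- Two contractions whose weights can be summed one after the other. -/
def Admissible (e e' : Contraction) : Prop :=
  e.Proper ∧ e'.Proper ∧ ∃ x ∈ e.src, x ∉ e'.verts

lemma sum_deg_list (L : List Contraction) :
    ∑ a, (L.map deg).sum a = L.length + L.countP Sum.isRight := by
  induction L with
  | nil => simp
  | cons e L ih =>
    simp only [List.map_cons, List.sum_cons, Pi.add_apply, Finset.sum_add_distrib, ih]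
    rcases e with p | p
    · simp [deg]; ring
    · rw [List.countP_cons_of_pos (by simp)]
      simp [deg, Finset.sum_add_distrib]; ring

lemma even_sum_deg {L : List Contraction} {u : Fin 4} (h : ∀ e ∈ L, Even (deg e u)) :
    Even ((L.map deg).sum u) := by
  induction L with
  | nil => simp
  | cons e L ih =>
    simp only [List.map_cons, List.sum_cons, Pi.add_apply]
    exact (h e (by simp)).add (ih fun e he => h e (by simp [he]))

lemma countP_isRight_le_of_forall_loop {L : List Contraction}
    (h : ∀ p, Sum.inr p ∈ L → p.1 = p.2) :
    L.countP Sum.isRight ≤ ∑ u, (L.map deg).sum u / 2 := by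
  induction L with
  | nil => simp
  | cons e L ih =>
    have ih := ih fun p hp => h p (by simp [hp])
    simp only [List.map_cons, List.sum_cons, Pi.add_apply]
    rcases e with p | p
    · rw [List.countP_cons_of_neg (by simp)]
      exact ih.trans (Finset.sum_le_sum fun u _ => by gcongr; simp)
    · have hp := h p (by simp)
      rw [List.countP_cons_of_pos (by simp)]
      have : ∑ u, (deg (.inr p) u + (L.map deg).sum u) / 2 =
          ∑ u, ((Pi.single p.1 1 : Fin 4 → ℕ) u + (L.map deg).sum u / 2) := by
        refine Finset.sum_congr rfl fun u _ => ?_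
        simp only [deg, ← hp, Pi.add_apply]
        omega
      rw [this, Finset.sum_add_distrib]
      simp
      omega

lemma exists_arrow_mem {L : List Contraction} {u : Fin 4} (hodd : Odd ((L.map deg).sum u))
    (h : ∀ p, Sum.inr p ∈ L → p.1 ≠ p.2 → u ≠ p.1 ∧ u ≠ p.2) : ∃ v, Sum.inl (u, v) ∈ L := by
  by_contra! hno
  refine Nat.not_even_iff_odd.2 hodd (even_sum_deg fun e he => ?_)
  rcases e with ⟨x, y⟩ | ⟨x, y⟩
  · have : u ≠ x := by rintro rfl; exact hno y he
    simp [deg, Pi.single_eq_of_ne this]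
  · rcases eq_or_ne x y with rfl | hxy
    · exact ⟨_, rfl⟩
    · have := h _ he hxy
      simp [deg, Pi.single_eq_of_ne this.1, Pi.single_eq_of_ne this.2]

lemma exists_admissible {L : List Contraction} {k : Fin 4 → ℕ} (hk : ∀ a, k a = 1 ∨ k a = 3)
    (hL : (L.map deg).sum = k) :
    ∃ e ∈ L, ∃ e' ∈ L, e ≠ e' ∧ Admissible e e' ∧
      order e + order e' + 2 ≤ L.length + ∑ a, (3 - k a) := by
  have hlen := sum_deg_list L
  rw [hL] at hlen
  have hk3 : ∑ a, (3 - k a) + ∑ a, k a = 12 := by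
    rw [← Finset.sum_add_distrib, Finset.sum_congr rfl (g := fun _ => 3)]
    · simp
    · intro a _; rcases hk a with h | h <;> simp [h]
  have hcount : L.length = L.countP Sum.isRight + L.countP (fun e => !Sum.isRight e) := by
    simpa using List.length_eq_countP_add_countP (l := L) Sum.isRight
  have hodd : ∀ u, Odd ((L.map deg).sum u) := by
    intro u; rw [hL]; rcases hk u with h | h <;> rw [h] <;> decide
  by_cases hpair : ∃ x y, x ≠ y ∧ Sum.inr (x, y) ∈ L
  · obtain ⟨x, y, hxy, hmem⟩ := hpair
    by_cases hpair2 : ∃ x' y', x' ≠ y' ∧ Sum.inr (x', y') ∈ L ∧ s(x, y) ≠ s(x', y')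
    · obtain ⟨x', y', hxy', hmem', hne⟩ := hpair2
      refine ⟨_, hmem, _, hmem', ?_, ⟨hxy, hxy', ?_⟩, ?_⟩
      · rintro h
        simp only [Sum.inr.injEq, Prod.mk.injEq] at h
        exact hne (by rw [h.1, h.2])
      · simp only [src, verts]
        clear * - hxy hxy' hne
        revert x y x' y'
        decide
      · simp only [order]
        omega
    · push Not at hpair2
      obtain ⟨u, hux, huy⟩ : ∃ u, u ≠ x ∧ u ≠ y := by clear * -; revert x y; decide
      obtain ⟨v, hv⟩ := exists_arrow_mem (hodd u) (by
        rintro ⟨x', y'⟩ hp hne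
        have := hpair2 x' y' hne hp
        rw [Sym2.eq_iff] at this
        rcases this with ⟨rfl, rfl⟩ | ⟨rfl, rfl⟩
        exacts [⟨hux, huy⟩, ⟨huy, hux⟩])
      refine ⟨_, hv, _, hmem, by simp, ⟨trivial, hxy, u, by simp [src], by simp [verts, hux, huy]⟩,
        ?_⟩
      have : 0 < L.countP (fun e => !Sum.isRight e) :=
        List.countP_pos_iff.2 ⟨_, hv, by simp⟩
      simp only [order]
      omega
  · push Not at hpair
    have hloop : ∀ p, Sum.inr p ∈ L → p.1 = p.2 := fun p hp => by
      by_contra h; exact hpair _ _ h hp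
    have harrow : ∀ u, ∃ v, Sum.inl (u, v) ∈ L := fun u =>
      exists_arrow_mem (hodd u) fun p hp hne => absurd (hloop p hp) hne
    obtain ⟨v, hv⟩ := harrow 0
    obtain ⟨u, hu0, huv⟩ : ∃ u, u ≠ 0 ∧ u ≠ v := by clear * -; revert v; decide
    obtain ⟨v', hv'⟩ := harrow u
    refine ⟨_, hv', _, hv, by simp [hu0], ⟨trivial, trivial, u, by simp [src],
      by simp [verts, hu0, huv]⟩, ?_⟩
    have h1 := countP_isRight_le_of_forall_loop hloop
    have h2 : ∑ u, (L.map deg).sum u / 2 ≤ ∑ u : Fin 4, 1 := Finset.sum_le_sum fun u _ => by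
      rw [hL]; rcases hk u with h | h <;> simp [h]
    simp only [Finset.sum_const, Finset.card_univ, Fintype.card_fin, smul_eq_mul] at h2
    simp only [order]
    omega

lemma prod_map_le {w : Contraction → ℝ} {ε : ℝ} (h0 : ∀ e, 0 ≤ w e) (hε : ∀ e, w e ≤ ε)
    (L : List Contraction) : (L.map w).prod ≤ ε ^ L.length := by
  induction L with
  | nil => simp
  | cons e L ih =>
    rw [List.map_cons, List.prod_cons, List.length_cons, pow_succ']
    exact mul_le_mul (hε e) ih (List.prod_nonneg (fun a ha => by
      obtain ⟨e, -, rfl⟩ := List.mem_map.1 ha; exact h0 e))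
      ((h0 e).trans (hε e))

lemma exists_perm_cons_cons {α : Type*} {L : List α} {e e' : α} (he : e ∈ L) (he' : e' ∈ L)
    (hne : e ≠ e') : ∃ L', L.Perm (e :: e' :: L') := by
  obtain ⟨s, t, rfl⟩ := List.append_of_mem he
  have he'' : e' ∈ s ++ t := by simpa [hne.symm] using he'
  obtain ⟨s', t', hst⟩ := List.append_of_mem he''
  refine ⟨s' ++ t', List.perm_middle.trans (List.Perm.cons e ?_)⟩
  rw [hst]
  exact List.perm_middle

lemma prod_map_le_of_mem {w : Contraction → ℝ} {ε : ℝ} (h0 : ∀ e, 0 ≤ w e) (hε : ∀ e, w e ≤ ε)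
    {L : List Contraction} {e e' : Contraction} (he : e ∈ L) (he' : e' ∈ L) (hne : e ≠ e') :
    (L.map w).prod ≤ w e * w e' * ε ^ (L.length - 2) := by
  obtain ⟨L', hL'⟩ := exists_perm_cons_cons he he' hne
  rw [(hL'.map w).prod_eq, List.map_cons, List.map_cons, List.prod_cons, List.prod_cons,
    ← mul_assoc, hL'.length_eq]
  exact mul_le_mul_of_nonneg_left (prod_map_le h0 hε _) (mul_nonneg (h0 _) (h0 _))

/-- Every complete list of contractions is dominated by an admissible pair of contractions. -/
lemma exists_admissible_le {w : Contraction → ℝ} {ε : ℝ} (h0 : ∀ e, 0 ≤ w e)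
    (hε : ∀ e, w e ≤ ε) (hε1 : ε ≤ 1) {L : List Contraction} {k : Fin 4 → ℕ}
    (hk : ∀ a, k a = 1 ∨ k a = 3) (hL : (L.map deg).sum = k) :
    ∃ e e', Admissible e e' ∧ ε ^ (∑ a, (3 - k a)) * (L.map w).prod ≤
      (ε ^ order e * w e) * (ε ^ order e' * w e') := by
  obtain ⟨e, he, e', he', hne, hadm, hle⟩ := exists_admissible hk hL
  have hε0 : 0 ≤ ε := (h0 e).trans (hε e)
  obtain ⟨L', hL'⟩ := exists_perm_cons_cons he he' hne
  have hlen : 2 ≤ L.length := by simp [hL'.length_eq]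
  refine ⟨e, e', hadm, ?_⟩
  calc ε ^ (∑ a, (3 - k a)) * (L.map w).prod
      ≤ ε ^ (∑ a, (3 - k a)) * (w e * w e' * ε ^ (L.length - 2)) := by
        gcongr; exact prod_map_le_of_mem h0 hε he he' hne
    _ = w e * w e' * ε ^ (∑ a, (3 - k a) + (L.length - 2)) := by rw [pow_add]; ring
    _ ≤ w e * w e' * ε ^ (order e + order e') :=
        mul_le_mul_of_nonneg_left (pow_le_pow_of_le_one hε0 hε1 (by omega))
          (mul_nonneg (h0 _) (h0 _))
    _ = _ := by rw [pow_add]; ring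

end Contraction

lemma card_mul_sum_eq_sum_sum_update {ι I : Type*} [Fintype ι] [DecidableEq ι] [Fintype I]
    (x : ι) (F : (ι → I) → ℝ) :
    (Fintype.card I : ℝ) * ∑ i, F i = ∑ i, ∑ j, F (Function.update i x j) := by
  let σ : (ι → I) × I ≃ (ι → I) × I :=
    Function.Involutive.toPerm (fun p => (Function.update p.1 x p.2, p.1 x)) fun p => by simp
  have h := Equiv.sum_comp σ (fun p => F p.1)
  rw [Fintype.sum_prod_type, Fintype.sum_prod_type] at h
  simp only [Finset.sum_const, Finset.card_univ, nsmul_eq_mul, ← Finset.mul_sum] at h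
  exact h.symm

namespace Contraction

/-- The weight of a contraction at the increments `i`, for weights `α` of the pairings of increments
with arguments and `γ` of the pairings of increments. -/
def weight {I : Type*} (α γ : I → I → ℝ) (i : Fin 4 → I) : Contraction → ℝ
  | .inl p => α (i p.1) (i p.2)
  | .inr p => γ (i p.1) (i p.2)

lemma weight_update_of_notMem {I : Type*} (α γ : I → I → ℝ) (i : Fin 4 → I) {e : Contraction}
    {x : Fin 4} (hx : x ∉ e.verts) (j : I) :
    weight α γ (Function.update i x j) e = weight α γ i e := by
  rcases e with p | p <;>
  · simp only [verts, Finset.mem_insert, Finset.mem_singleton, not_or] at hx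
    simp [weight, Function.update_of_ne (Ne.symm hx.1), Function.update_of_ne (Ne.symm hx.2)]

variable {I : Type*} {α γ : I → I → ℝ} {ε A : ℝ}

lemma sum_weight_update_le [Fintype I] (hsymm : ∀ j j', γ j j' = γ j' j)
    (hα : ∀ j', ∑ j, ε ^ 3 * α j j' ≤ A) (hα' : ∑ j, ε ^ 3 * α j j ≤ A)
    (hγ : ∀ j', ∑ j, ε ^ 2 * γ j j' ≤ A) {e : Contraction} (he : e.Proper) {x : Fin 4}
    (hx : x ∈ e.src) (i : Fin 4 → I) :
    ∑ j, ε ^ order e * weight α γ (Function.update i x j) e ≤ A := by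
  rcases e with ⟨u, v⟩ | ⟨u, v⟩
  · obtain rfl : x = u := by simpa [src] using hx
    rcases eq_or_ne x v with rfl | h
    · simpa [weight, order] using hα'
    · simpa [weight, order, Function.update_of_ne h.symm] using hα (i v)
  · have he : u ≠ v := he
    simp only [src, Finset.mem_insert, Finset.mem_singleton] at hx
    rcases hx with rfl | rfl
    · simpa [weight, order, Function.update_of_ne he.symm] using hγ (i v)
    · simpa [weight, order, Function.update_of_ne he, hsymm (i u)] using hγ (i u)

lemma sum_weight_mul_weight_le [Fintype I] (hε : 0 ≤ ε) (hα0 : ∀ j j', 0 ≤ α j j')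
    (hγ0 : ∀ j j', 0 ≤ γ j j') (hsymm : ∀ j j', γ j j' = γ j' j)
    (hα : ∀ j', ∑ j, ε ^ 3 * α j j' ≤ A) (hα' : ∑ j, ε ^ 3 * α j j ≤ A)
    (hγ : ∀ j', ∑ j, ε ^ 2 * γ j j' ≤ A) {e e' : Contraction} (h : Admissible e e') :
    ∑ i, (ε ^ order e * weight α γ i e) * (ε ^ order e' * weight α γ i e') ≤
      A ^ 2 * Fintype.card I ^ 2 := by
  obtain ⟨he, he', x, hx, hx'⟩ := h
  rcases isEmpty_or_nonempty I with hI | hI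
  · simp
  have hA : 0 ≤ A := le_trans (Finset.sum_nonneg fun j _ =>
    mul_nonneg (pow_nonneg hε _) (hα0 j j)) hα'
  have hw : ∀ i e, 0 ≤ ε ^ order e * weight α γ i e := by
    rintro i (p | p)
    exacts [mul_nonneg (pow_nonneg hε _) (hα0 _ _), mul_nonneg (pow_nonneg hε _) (hγ0 _ _)]
  have hN : (0 : ℝ) < Fintype.card I := by exact_mod_cast Fintype.card_pos
  obtain ⟨y, hy⟩ : ∃ y, y ∈ e'.src := by
    rcases e' with p | p <;> exact ⟨p.1, by simp [src]⟩
  have h1 := card_mul_sum_eq_sum_sum_update x fun i : Fin 4 → I =>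
    (ε ^ order e * weight α γ i e) * (ε ^ order e' * weight α γ i e')
  have h2 := card_mul_sum_eq_sum_sum_update y fun i : Fin 4 → I => ε ^ order e' * weight α γ i e'
  simp only [weight_update_of_notMem α γ _ hx', ← Finset.sum_mul] at h1
  have h3 : (Fintype.card I : ℝ) *
      ∑ i, (ε ^ order e * weight α γ i e) * (ε ^ order e' * weight α γ i e') ≤
      A * ∑ i, ε ^ order e' * weight α γ i e' := by
    rw [h1, Finset.mul_sum]
    exact Finset.sum_le_sum fun i _ => mul_le_mul_of_nonneg_right
      (sum_weight_update_le hsymm hα hα' hγ he hx i) (hw _ _)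
  have h4 : (Fintype.card I : ℝ) * ∑ i, ε ^ order e' * weight α γ i e' ≤
      Fintype.card I ^ 4 * A := by
    rw [h2]
    refine (Finset.sum_le_sum fun i _ => sum_weight_update_le hsymm hα hα' hγ he' hy i).trans_eq ?_
    simp
  refine le_of_mul_le_mul_left ?_ (pow_pos hN 2)
  calc (Fintype.card I : ℝ) ^ 2 *
        ∑ i, (ε ^ order e * weight α γ i e) * (ε ^ order e' * weight α γ i e')
      = Fintype.card I * (Fintype.card I *
        ∑ i, (ε ^ order e * weight α γ i e) * (ε ^ order e' * weight α γ i e')) := by ring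
    _ ≤ Fintype.card I * (A * ∑ i, ε ^ order e' * weight α γ i e') := by gcongr
    _ = A * (Fintype.card I * ∑ i, ε ^ order e' * weight α γ i e') := by ring
    _ ≤ A * (Fintype.card I ^ 4 * A) := by gcongr
    _ = _ := by ring

open Classical in
/-- The sum of the weights of all admissible pairs of contractions. -/
def admissibleSum (α γ : I → I → ℝ) (ε : ℝ) (i : Fin 4 → I) : ℝ :=
  ∑ q : Contraction × Contraction, if Admissible q.1 q.2 then
    (ε ^ order q.1 * weight α γ i q.1) * (ε ^ order q.2 * weight α γ i q.2) else 0

lemma admissibleSum_nonneg (hε : 0 ≤ ε) (hα0 : ∀ j j', 0 ≤ α j j') (hγ0 : ∀ j j', 0 ≤ γ j j')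
    (i : Fin 4 → I) : 0 ≤ admissibleSum α γ ε i := by
  have hw : ∀ e, 0 ≤ ε ^ order e * weight α γ i e := by
    rintro (p | p)
    exacts [mul_nonneg (pow_nonneg hε _) (hα0 _ _), mul_nonneg (pow_nonneg hε _) (hγ0 _ _)]
  refine Finset.sum_nonneg fun q _ => ?_
  split_ifs
  exacts [mul_nonneg (hw _) (hw _), le_rfl]

lemma le_admissibleSum (hα0 : ∀ j j', 0 ≤ α j j') (hγ0 : ∀ j j', 0 ≤ γ j j')
    (hαε : ∀ j j', α j j' ≤ ε) (hγε : ∀ j j', γ j j' ≤ ε) (hε1 : ε ≤ 1) (i : Fin 4 → I)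
    {L : List Contraction} {k : Fin 4 → ℕ} (hk : ∀ a, k a = 1 ∨ k a = 3)
    (hL : (L.map deg).sum = k) :
    ε ^ (∑ a, (3 - k a)) * (L.map (weight α γ i)).prod ≤ admissibleSum α γ ε i := by
  classical
  have h0 : ∀ e, 0 ≤ weight α γ i e := by
    rintro (p | p)
    exacts [hα0 _ _, hγ0 _ _]
  have h1 : ∀ e, weight α γ i e ≤ ε := by
    rintro (p | p)
    exacts [hαε _ _, hγε _ _]
  have hε : 0 ≤ ε := (h0 (.inl 0)).trans (h1 _)
  obtain ⟨e, e', hadm, hle⟩ := exists_admissible_le h0 h1 hε1 hk hL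
  refine hle.trans ?_
  have hw : ∀ e, 0 ≤ ε ^ order e * weight α γ i e := fun e => mul_nonneg (pow_nonneg hε _) (h0 e)
  refine le_trans (by simp [hadm]) (Finset.single_le_sum
    (f := fun q : Contraction × Contraction => if Admissible q.1 q.2 then
      (ε ^ order q.1 * weight α γ i q.1) * (ε ^ order q.2 * weight α γ i q.2) else 0)
    (fun q _ => ?_) (Finset.mem_univ (e, e')))
  split_ifs
  exacts [mul_nonneg (hw _) (hw _), le_rfl]

lemma sum_admissibleSum_le [Fintype I] (hε : 0 ≤ ε) (hα0 : ∀ j j', 0 ≤ α j j')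
    (hγ0 : ∀ j j', 0 ≤ γ j j') (hsymm : ∀ j j', γ j j' = γ j' j)
    (hα : ∀ j', ∑ j, ε ^ 3 * α j j' ≤ A) (hα' : ∑ j, ε ^ 3 * α j j ≤ A)
    (hγ : ∀ j', ∑ j, ε ^ 2 * γ j j' ≤ A) :
    ∑ i, admissibleSum α γ ε i ≤ 1024 * (A ^ 2 * Fintype.card I ^ 2) := by
  classical
  simp only [admissibleSum]
  rw [Finset.sum_comm]
  refine (Finset.sum_le_sum (g := fun _ => A ^ 2 * (Fintype.card I : ℝ) ^ 2) fun q _ => ?_).trans_eq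
    ?_
  · split_ifs with h
    · exact sum_weight_mul_weight_le hε hα0 hγ0 hsymm hα hα' hγ h
    · simp; positivity
  · simp only [Finset.sum_const, Finset.card_univ, nsmul_eq_mul]
    norm_num [Fintype.card_prod, Fintype.card_sum]

end Contraction

lemma prod_mul_cube_sub (G : Fin 4 → ℕ → ℝ → ℝ → ℝ) (w : Fin 4 ⊕ Fin 4 → ℝ) (y : Fin 4 → ℝ)
    (ε : ℝ) :
    ∏ a, (G a 0 (w (.inr a)) (y a) * (w (.inl a) ^ 3 - 3 * ε ^ 2 * w (.inl a))) =
      ∑ p : Fin 4 → Bool, (∏ a, if p a then 1 else -(3 * ε ^ 2)) *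
        mixedMonomial G (fun a => if p a then 3 else 1) 0 w y := by
  have h : ∀ a, G a 0 (w (.inr a)) (y a) * (w (.inl a) ^ 3 - 3 * ε ^ 2 * w (.inl a)) =
      ∑ b : Bool, (if b then 1 else -(3 * ε ^ 2)) * (G a 0 (w (.inr a)) (y a) *
        w (.inl a) ^ (if b then 3 else 1)) := by
    intro a
    simp
    ring
  simp only [h]
  rw [Finset.prod_univ_sum]
  simp only [mixedMonomial, ← Finset.prod_mul_distrib]
  exact Finset.sum_congr (by ext; simp) fun _ _ => rfl

lemma abs_integral_prod_mul_cube_sub_le {Ω I : Type*} [MeasurableSpace Ω]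
    {P : Measure Ω} [IsProbabilityMeasure P] {δ m z : Fin 4 → Ω → ℝ}
    (hS : IsGaussianSetup P δ m z) {G : Fin 4 → ℕ → ℝ → ℝ → ℝ} {M : ℕ → ℝ} (hG : IsDerivSeq G M)
    {α γ : I → I → ℝ} {ε : ℝ} {i : Fin 4 → I}
    (hα : ∀ u v, |cov[δ u, m v; P]| ≤ α (i u) (i v))
    (hγ : ∀ u v, |cov[δ u, δ v; P]| ≤ γ (i u) (i v))
    (hα0 : ∀ j j', 0 ≤ α j j') (hγ0 : ∀ j j', 0 ≤ γ j j')
    (hαε : ∀ j j', α j j' ≤ ε) (hγε : ∀ j j', γ j j' ≤ ε) (hε1 : ε ≤ 1) :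
    |∫ ω, ∏ a, (G a 0 (m a ω) (z a ω) * (δ a ω ^ 3 - 3 * ε ^ 2 * δ a ω)) ∂P| ≤
      16 * (81 * (16 ^ 12 * (M 12 ^ 4 * Contraction.admissibleSum α γ ε i))) := by
  have hε : 0 ≤ ε := (hα0 (i 0) (i 0)).trans (hαε _ _)
  have hB := Contraction.admissibleSum_nonneg hε hα0 hγ0 i
  have hM := hG.nonneg 12
  have hexp : ∀ ω, ∏ a, (G a 0 (m a ω) (z a ω) * (δ a ω ^ 3 - 3 * ε ^ 2 * δ a ω)) =
      ∑ p : Fin 4 → Bool, (∏ a, if p a then 1 else -(3 * ε ^ 2)) *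
        mixedMonomial G (fun a => if p a then 3 else 1) 0 (fun s => Sum.elim δ m s ω)
          (fun a => z a ω) := fun ω =>
    prod_mul_cube_sub G (fun s => Sum.elim δ m s ω) (fun a => z a ω) ε
  simp only [hexp]
  rw [integral_finsetSum _ fun p _ => (integrable_mixedMonomial hS hG _ _).const_mul _]
  refine (Finset.abs_sum_le_sum_abs _ _).trans ((Finset.sum_le_sum (g := fun _ =>
    81 * (16 ^ 12 * (M 12 ^ 4 * Contraction.admissibleSum α γ ε i))) fun p _ => ?_).trans_eq
    (by simp))
  set k : Fin 4 → ℕ := fun a => if p a then 3 else 1 with hk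
  have hk13 : ∀ a, k a = 1 ∨ k a = 3 := fun a => by
    by_cases h : p a = true <;> simp [hk, h]
  have hksum : ∑ a, k a ≤ 12 :=
    (Finset.sum_le_sum (g := fun _ => 3) fun a _ => by
      rcases hk13 a with h | h <;> simp [h]).trans_eq (by simp)
  have hbound := mixedMoment_bound hS hG (w := Contraction.weight α γ i) (fun u v => hα u v)
    (fun u v => hγ u v) 12 hB (∑ a, k a) k 0 (ε ^ ∑ a, (3 - k a)) rfl
    (fun b => by simpa using hksum) (by positivity)
    (fun L hL => Contraction.le_admissibleSum hα0 hγ0 hαε hγε hε1 i hk13 hL)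
  have hcoef : |∏ a, if p a then 1 else -(3 * ε ^ 2)| ≤ 81 * ε ^ ∑ a, (3 - k a) := by
    rw [Finset.abs_prod, ← Finset.prod_pow_eq_pow_sum]
    have h81 : (81 : ℝ) = ∏ _a : Fin 4, 3 := by norm_num
    rw [h81, ← Finset.prod_mul_distrib]
    refine Finset.prod_le_prod (fun _ _ => abs_nonneg _) fun a _ => ?_
    by_cases h : p a = true
    · simp [hk, h]
    · simp [hk, h, abs_of_nonneg hε]
  rw [integral_const_mul, abs_mul]
  calc |∏ a, if p a then 1 else -(3 * ε ^ 2)| * |mixedMoment P δ m z G k 0|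
      ≤ 81 * ε ^ (∑ a, (3 - k a)) * |mixedMoment P δ m z G k 0| := by gcongr
    _ = 81 * (ε ^ (∑ a, (3 - k a)) * |mixedMoment P δ m z G k 0|) := by ring
    _ ≤ 81 * ((4 + (12 : ℕ)) ^ (∑ a, k a) *
        (M 12 ^ 4 * Contraction.admissibleSum α γ ε i)) := by gcongr
    _ ≤ 81 * (16 ^ 12 * (M 12 ^ 4 * Contraction.admissibleSum α γ ε i)) := by
      have : ((4 : ℝ) + (12 : ℕ)) ^ (∑ a, k a) ≤ 16 ^ 12 := by
        rw [show (4 : ℝ) + (12 : ℕ) = 16 by norm_num]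
        exact pow_le_pow_right₀ (by norm_num) hksum
      gcongr

/-- The cube root of the absolute value. -/
def absCbrt (x : ℝ) : ℝ := |x| ^ (1 / 3 : ℝ)

lemma absCbrt_nonneg (x : ℝ) : 0 ≤ absCbrt x := by unfold absCbrt; positivity

@[simp] lemma absCbrt_zero : absCbrt 0 = 0 := by simp [absCbrt]

@[simp] lemma absCbrt_one : absCbrt 1 = 1 := by simp [absCbrt]

lemma absCbrt_neg (x : ℝ) : absCbrt (-x) = absCbrt x := by simp [absCbrt]

lemma absCbrt_sub_comm (x y : ℝ) : absCbrt (x - y) = absCbrt (y - x) := by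
  rw [← absCbrt_neg, neg_sub]

lemma absCbrt_mul (x y : ℝ) : absCbrt (x * y) = absCbrt x * absCbrt y := by
  rw [absCbrt, abs_mul, Real.mul_rpow (abs_nonneg _) (abs_nonneg _), absCbrt, absCbrt]

lemma absCbrt_le_absCbrt {x y : ℝ} (h : |x| ≤ |y|) : absCbrt x ≤ absCbrt y :=
  Real.rpow_le_rpow (abs_nonneg _) h (by norm_num)

lemma absCbrt_pow_three {x : ℝ} (hx : 0 ≤ x) : absCbrt (x ^ 3) = x := by
  rw [absCbrt, abs_of_nonneg (by positivity), ← Real.rpow_natCast, ← Real.rpow_mul hx]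
  norm_num

lemma pow_three_absCbrt {x : ℝ} (hx : 0 ≤ x) : absCbrt x ^ 3 = x := by
  rw [absCbrt, abs_of_nonneg hx, ← Real.rpow_natCast, ← Real.rpow_mul hx]
  norm_num

lemma absCbrt_add_le (x y : ℝ) : absCbrt (x + y) ≤ absCbrt x + absCbrt y :=
  (Real.rpow_le_rpow (abs_nonneg _) (abs_add_le x y) (by norm_num)).trans
    (Real.rpow_add_le_add_rpow (abs_nonneg _) (abs_nonneg _) (by norm_num) (by norm_num))

lemma abs_absCbrt_sub_le (x y : ℝ) : |absCbrt x - absCbrt y| ≤ absCbrt (x - y) := by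
  have h1 := absCbrt_add_le (x - y) y
  have h2 := absCbrt_add_le (y - x) x
  rw [absCbrt_sub_comm y x] at h2
  simp only [sub_add_cancel] at h1 h2
  rw [abs_le]
  constructor <;> linarith

lemma absCbrt_add_one_add_absCbrt_sub_one_le {x : ℝ} (hx : 1 ≤ |x|) :
    absCbrt (x + 1) + absCbrt (x - 1) ≤ 2 * absCbrt x := by
  wlog h0 : 0 ≤ x generalizing x
  · have h := this (x := -x) (by rwa [abs_neg]) (by linarith)
    rw [show -x + 1 = -(x - 1) by ring, show -x - 1 = -(x + 1) by ring] at h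
    simp only [absCbrt_neg] at h
    linarith
  rw [abs_of_nonneg h0] at hx
  have hconc : ConcaveOn ℝ (Set.Ici 0) fun y : ℝ => y ^ (1 / 3 : ℝ) :=
    Real.concaveOn_rpow (by norm_num) (by norm_num)
  have h := hconc.2 (Set.mem_Ici.2 (by linarith : 0 ≤ x + 1))
    (Set.mem_Ici.2 (by linarith : 0 ≤ x - 1)) (by norm_num : (0 : ℝ) ≤ 1 / 2)
    (by norm_num : (0 : ℝ) ≤ 1 / 2) (by norm_num)
  simp only [smul_eq_mul] at h
  rw [show 1 / 2 * (x + 1) + 1 / 2 * (x - 1) = x by ring] at h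
  rw [absCbrt, absCbrt, absCbrt, abs_of_nonneg (by linarith : 0 ≤ x + 1),
    abs_of_nonneg (by linarith : 0 ≤ x - 1), abs_of_nonneg h0]
  linarith

lemma covH_one_sixth (s t : ℝ) :
    covH (1 / 6) s t = (absCbrt s + absCbrt t - absCbrt (s - t)) / 2 := by
  rw [covH, show (2 * (1 / 6) : ℝ) = 1 / 3 by norm_num, absCbrt, absCbrt, absCbrt]

lemma covH_self (s : ℝ) : covH (1 / 6) s s = absCbrt s := by
  rw [covH_one_sixth, sub_self, absCbrt_zero]
  ring

lemma covH_mul_pow_three {ε : ℝ} (hε : 0 ≤ ε) (s t : ℝ) :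
    covH (1 / 6) (s * ε ^ 3) (t * ε ^ 3) =
      ε * ((absCbrt s + absCbrt t - absCbrt (s - t)) / 2) := by
  rw [covH_one_sixth, ← sub_mul, absCbrt_mul, absCbrt_mul, absCbrt_mul, absCbrt_pow_three hε]
  ring

/-- The covariance of the `j`-th unit increment with the value at the integer time `i`. -/
def incrNodeCov (j i : ℕ) : ℝ :=
  (absCbrt (j + 1) - absCbrt j - absCbrt (j + 1 - i) + absCbrt (j - i)) / 2

/-- The covariance of the `j`-th and `i`-th unit increments. -/
def incrIncrCov (j i : ℕ) : ℝ :=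
  (absCbrt (j - i + 1) + absCbrt (j - i - 1) - 2 * absCbrt (j - i)) / 2

lemma incrIncrCov_eq (j i : ℕ) : incrIncrCov j i = incrNodeCov j (i + 1) - incrNodeCov j i := by
  simp only [incrIncrCov, incrNodeCov, Nat.cast_add, Nat.cast_one]
  rw [show (j : ℝ) + 1 - (i + 1) = j - i by ring, show (j : ℝ) - (i + 1) = j - i - 1 by ring,
    show (j : ℝ) + 1 - i = j - i + 1 by ring]
  ring

lemma incrIncrCov_symm (j i : ℕ) : incrIncrCov j i = incrIncrCov i j := by
  simp only [incrIncrCov]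
  rw [show (j : ℝ) - i + 1 = -(i - j - 1) by ring, show (j : ℝ) - i - 1 = -(i - j + 1) by ring,
    show (j : ℝ) - i = -(i - j) by ring]
  simp only [absCbrt_neg]
  ring

lemma incrIncrCov_self (j : ℕ) : incrIncrCov j j = 1 := by
  simp [incrIncrCov, absCbrt_neg]

lemma abs_incrNodeCov_le (j i : ℕ) : |incrNodeCov j i| ≤ 1 := by
  have h1 := abs_le.1 (abs_absCbrt_sub_le (j + 1) j)
  have h2 := abs_le.1 (abs_absCbrt_sub_le (j + 1 - i) (j - i))
  rw [show (j : ℝ) + 1 - j = 1 by ring, absCbrt_one] at h1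
  rw [show (j : ℝ) + 1 - i - (j - i) = 1 by ring, absCbrt_one] at h2
  rw [incrNodeCov, abs_le]
  constructor <;> linarith [h1.1, h1.2, h2.1, h2.2]

lemma abs_incrIncrCov_le (j i : ℕ) : |incrIncrCov j i| ≤ 1 := by
  have h1 := abs_le.1 (abs_absCbrt_sub_le (j - i + 1) (j - i))
  have h2 := abs_le.1 (abs_absCbrt_sub_le (j - i) (j - i - 1))
  rw [show (j : ℝ) - i + 1 - (j - i) = 1 by ring, absCbrt_one] at h1
  rw [show (j : ℝ) - i - (j - i - 1) = 1 by ring, absCbrt_one] at h2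
  rw [incrIncrCov, abs_le]
  constructor <;> linarith [h1.1, h1.2, h2.1, h2.2]

lemma one_le_abs_natCast_sub {j i : ℕ} (h : j ≠ i) : 1 ≤ |(j : ℝ) - i| := by
  have h : (1 : ℤ) ≤ |(j : ℤ) - i| := Int.one_le_abs (sub_ne_zero.2 (by exact_mod_cast h))
  exact_mod_cast h

lemma sum_abs_incrIncrCov_le (N i : ℕ) : ∑ j ∈ Finset.range N, |incrIncrCov j i| ≤ 3 := by
  set D : ℕ → ℝ := fun j => (absCbrt (j - i) - absCbrt (j - i - 1)) / 2 with hD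
  have hDle : ∀ j, |D j| ≤ 1 / 2 := fun j => by
    have h := abs_absCbrt_sub_le (j - i) (j - i - 1)
    rw [show (j : ℝ) - i - (j - i - 1) = 1 by ring, absCbrt_one] at h
    rw [hD]
    dsimp only
    rw [abs_div, abs_two]
    linarith
  have hρ : ∀ j, |incrIncrCov j i| ≤ -(D (j + 1) - D j) + if j = i then 2 else 0 := by
    intro j
    have e : D (j + 1) - D j = incrIncrCov j i := by
      simp only [hD, incrIncrCov, Nat.cast_add, Nat.cast_one]
      rw [show (j : ℝ) + 1 - i = j - i + 1 by ring, add_sub_cancel_right]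
      ring
    rw [e]
    split_ifs with h
    · rw [h, incrIncrCov_self]; norm_num
    · have := absCbrt_add_one_add_absCbrt_sub_one_le (one_le_abs_natCast_sub h)
      rw [add_zero, abs_of_nonpos]
      rw [incrIncrCov]
      linarith
  refine (Finset.sum_le_sum fun j _ => hρ j).trans ?_
  rw [Finset.sum_add_distrib, Finset.sum_neg_distrib, Finset.sum_range_sub]
  have h1 : ∑ j ∈ Finset.range N, (if j = i then (2 : ℝ) else 0) ≤ 2 := by
    rw [Finset.sum_ite_eq']
    split_ifs <;> norm_num
  linarith [(abs_le.1 (hDle N)).1, (abs_le.1 (hDle 0)).2]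

lemma absCbrt_natCast_le_succ (j : ℕ) : absCbrt j ≤ absCbrt (j + 1) :=
  absCbrt_le_absCbrt (by
    rw [abs_of_nonneg (Nat.cast_nonneg j), abs_of_nonneg (by positivity)]
    linarith)

lemma sum_absCbrt_sub (N : ℕ) :
    ∑ j ∈ Finset.range N, (absCbrt (j + 1) - absCbrt j) = absCbrt N := by
  simpa using Finset.sum_range_sub (fun j : ℕ => absCbrt j) N

lemma sum_abs_incrNodeCov_le {N i : ℕ} (hi : i ≤ N) :
    ∑ j ∈ Finset.range N, |incrNodeCov j i| ≤ 3 / 2 * absCbrt N := by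
  set ψ : ℕ → ℝ := fun j => if i ≤ j then absCbrt (j - i) else -absCbrt (j - i) with hψ
  have hstep : ∀ j, |incrNodeCov j i| ≤
      ((absCbrt (j + 1) - absCbrt j) + (ψ (j + 1) - ψ j)) / 2 := by
    intro j
    have h1 := absCbrt_natCast_le_succ j
    have h2 : |absCbrt (j + 1 - i) - absCbrt (j - i)| ≤ ψ (j + 1) - ψ j := by
      rcases le_or_gt i j with h | h
      · have hc : (i : ℝ) ≤ j := by exact_mod_cast h
        simp only [hψ, if_pos h, if_pos (Nat.le_succ_of_le h), Nat.cast_add, Nat.cast_one]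
        rw [abs_of_nonneg]
        refine sub_nonneg.2 (absCbrt_le_absCbrt ?_)
        rw [abs_of_nonneg (by linarith), abs_of_nonneg (by linarith)]
        linarith
      · have hc : (j : ℝ) + 1 ≤ i := by exact_mod_cast h
        have e : ψ (j + 1) = -absCbrt (j + 1 - i) := by
          rcases Nat.eq_or_lt_of_le (Nat.succ_le_of_lt h) with h' | h'
          · simp [hψ, ← h']
          · simp [hψ, not_le.2 h']
        have e' : ψ j = -absCbrt (j - i) := by simp [hψ, not_le.2 h]
        rw [e, e', abs_of_nonpos]
        · linarith
        refine sub_nonpos.2 (absCbrt_le_absCbrt ?_)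
        rw [abs_of_nonpos (by linarith), abs_of_nonpos (by linarith)]
        linarith
    rw [incrNodeCov, abs_le]
    have h3 := abs_le.1 h2
    constructor <;> linarith [h3.1, h3.2]
  refine (Finset.sum_le_sum fun j _ => hstep j).trans ?_
  rw [← Finset.sum_div, Finset.sum_add_distrib, Finset.sum_range_sub, sum_absCbrt_sub]
  have hc : (i : ℝ) ≤ N := by exact_mod_cast hi
  have h1 : ψ N ≤ absCbrt N := by
    simp only [hψ, if_pos hi]
    refine absCbrt_le_absCbrt ?_
    rw [abs_of_nonneg (by linarith), abs_of_nonneg (by positivity)]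
    linarith [(Nat.cast_nonneg i : (0 : ℝ) ≤ i)]
  have h2 : -absCbrt N ≤ ψ 0 := by
    have h3 : absCbrt i ≤ absCbrt N := absCbrt_le_absCbrt (by
      rw [abs_of_nonneg (by positivity), abs_of_nonneg (by positivity)]; exact hc)
    simp only [hψ, Nat.cast_zero, zero_sub, absCbrt_neg]
    split_ifs
    · linarith [absCbrt_nonneg i, absCbrt_nonneg N]
    · linarith
  linarith

lemma sum_abs_incrNodeCov_self_le (N : ℕ) :
    ∑ j ∈ Finset.range N, |(incrNodeCov j (j + 1) + incrNodeCov j j) / 2| ≤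
      3 / 2 * absCbrt N := by
  have h : ∀ j : ℕ, |(incrNodeCov j (j + 1) + incrNodeCov j j) / 2| =
      (absCbrt (j + 1) - absCbrt j) / 2 := fun j => by
    rw [incrNodeCov, incrNodeCov]
    have := absCbrt_natCast_le_succ j
    have h2 : (j : ℝ) - (j + 1 : ℕ) = -1 := by push_cast; ring
    rw [h2, absCbrt_neg]
    simp only [Nat.cast_add, Nat.cast_one, sub_self, absCbrt_zero, absCbrt_one,
      add_sub_cancel_left]
    rw [abs_of_nonneg] <;> linarith
  simp only [h]
  rw [← Finset.sum_div, sum_absCbrt_sub]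
  linarith [absCbrt_nonneg N]

section
variable {Ω : Type*} [MeasurableSpace Ω] {P : Measure Ω} {X Z : ℝ → Ω → ℝ}

lemma IsCenteredGaussianProcess.isGaussianProcess {C : ℝ → ℝ → ℝ}
    (hX : IsCenteredGaussianProcess P X C) : IsGaussianProcess X P := by
  refine ⟨fun I => ⟨isGaussian_of_map_eq_gaussianReal fun L => ?_⟩⟩
  have e := I.equivFin
  set c : Fin I.card → ℝ := fun i => L fun j => if e.symm i = j then 1 else 0 with hc
  refine ⟨0, _, Eq.trans ?_ (hX.2 I.card (fun i => e.symm i) c)⟩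
  have hm : Measurable fun ω => I.restrict fun x => X x ω := measurable_pi_lambda _ fun i => hX.1 i
  rw [Measure.map_map L.continuous.measurable hm]
  congr 1
  ext ω
  have h := LinearMap.pi_apply_eq_sum_univ L.toLinearMap (I.restrict fun x => X x ω)
  simp only [ContinuousLinearMap.coe_coe] at h
  rw [Function.comp_apply, h, ← e.symm.sum_comp]
  exact Finset.sum_congr rfl fun i _ => by simp [hc, mul_comm]

lemma IsCenteredGaussianProcess.memLp {C : ℝ → ℝ → ℝ} (hX : IsCenteredGaussianProcess P X C)
    (t : ℝ) : MemLp (X t) 2 P :=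
  (hX.isGaussianProcess.hasGaussianLaw_eval t).memLp_two

lemma IsCenteredGaussianProcess.integral_eq_zero {C : ℝ → ℝ → ℝ}
    (hX : IsCenteredGaussianProcess P X C) (t : ℝ) : ∫ ω, X t ω ∂P = 0 := by
  have h := hX.2 1 (fun _ => t) (fun _ => 1)
  simp only [Finset.univ_unique, Finset.sum_const, Finset.card_singleton, one_smul, one_mul] at h
  have hlaw : HasLaw (X t) _ P := ⟨(hX.1 t).aemeasurable, h⟩
  rw [hlaw.integral_eq, integral_id_gaussianReal]

lemma IsCenteredGaussianProcess.variance_sum {C : ℝ → ℝ → ℝ}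
    (hX : IsCenteredGaussianProcess P X C) (m : ℕ) (ts c : Fin m → ℝ) :
    Var[fun ω => ∑ i, c i * X (ts i) ω; P] =
      (∑ i, ∑ j, c i * c j * C (ts i) (ts j)).toNNReal := by
  have hm : Measurable fun ω => ∑ i, c i * X (ts i) ω :=
    Finset.measurable_sum _ fun i _ => (hX.1 _).const_mul _
  have h : HasLaw (fun ω => ∑ i, c i * X (ts i) ω) _ P := ⟨hm.aemeasurable, hX.2 m ts c⟩
  rw [h.variance_eq, variance_id_gaussianReal]

lemma IsCenteredGaussianProcess.variance_eq (hX : IsCenteredGaussianProcess P X (covH (1 / 6)))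
    (s : ℝ) : Var[X s; P] = absCbrt s := by
  have h := hX.variance_sum 1 (fun _ => s) (fun _ => 1)
  simp only [Finset.univ_unique, Finset.sum_const, Finset.card_singleton, one_smul, one_mul,
    covH_self, Real.coe_toNNReal _ (absCbrt_nonneg s)] at h
  exact h

lemma IsCenteredGaussianProcess.covariance_eq [IsProbabilityMeasure P]
    (hX : IsCenteredGaussianProcess P X (covH (1 / 6))) (s t : ℝ) :
    cov[X s, X t; P] = covH (1 / 6) s t := by
  have h := hX.variance_sum 2 ![s, t] ![1, 1]
  have hsub := absCbrt_add_le s (-t)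
  rw [absCbrt_neg, ← sub_eq_add_neg] at hsub
  have hnn := absCbrt_nonneg s
  have hnn' := absCbrt_nonneg t
  simp only [Fin.sum_univ_two, Matrix.cons_val_zero, Matrix.cons_val_one, one_mul] at h
  rw [variance_fun_add (hX.memLp s) (hX.memLp t), hX.variance_eq, hX.variance_eq, covH_self,
    covH_self, covH_one_sixth, covH_one_sixth, absCbrt_sub_comm t s,
    Real.coe_toNNReal _ (by linarith)] at h
  rw [covH_one_sixth]
  linarith

/-- The standard deviation of an increment over one dyadic step. -/
def stepDev (n : ℕ) : ℝ := (2 : ℝ) ^ (-(n : ℝ) / 6)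

lemma stepDev_pos (n : ℕ) : 0 < stepDev n := Real.rpow_pos_of_pos two_pos _

lemma stepDev_le_one (n : ℕ) : stepDev n ≤ 1 :=
  Real.rpow_le_one_of_one_le_of_nonpos one_le_two (by
    have : (0 : ℝ) ≤ n := Nat.cast_nonneg n
    linarith)

lemma stepDev_sq (n : ℕ) : stepDev n ^ 2 = (2 : ℝ) ^ (-(n : ℝ) / 3) := by
  rw [stepDev, ← Real.rpow_natCast, ← Real.rpow_mul two_pos.le]
  congr 1
  push_cast
  ring

lemma stepDev_pow_three (n : ℕ) : stepDev n ^ 3 = (2 : ℝ) ^ (-(n : ℝ) / 2) := by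
  rw [stepDev, ← Real.rpow_natCast, ← Real.rpow_mul two_pos.le]
  congr 1
  push_cast
  ring

lemma dyadicPt_eq (n j : ℕ) : dyadicPt n j = j * stepDev n ^ 3 := by
  rw [dyadicPt, stepDev_pow_three]

/-- The midpoint of the values of `X` at the ends of a dyadic step. -/
def midpt (X : ℝ → Ω → ℝ) (n j : ℕ) (ω : Ω) : ℝ :=
  (X (dyadicPt n (j + 1)) ω + X (dyadicPt n j) ω) / 2

lemma memLp_Xincr (hX : IsCenteredGaussianProcess P X (covH (1 / 6))) (n j : ℕ) :
    MemLp (Xincr X n j) 2 P := (hX.memLp _).sub (hX.memLp _)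

variable [IsProbabilityMeasure P]

lemma covariance_Xincr_eval (hX : IsCenteredGaussianProcess P X (covH (1 / 6))) (n j i : ℕ) :
    cov[Xincr X n j, X (dyadicPt n i); P] = stepDev n * incrNodeCov j i := by
  unfold Xincr
  rw [covariance_fun_sub_left (hX.memLp _) (hX.memLp _) (hX.memLp _), hX.covariance_eq,
    hX.covariance_eq, dyadicPt_eq, dyadicPt_eq, dyadicPt_eq, covH_mul_pow_three (stepDev_pos n).le,
    covH_mul_pow_three (stepDev_pos n).le, incrNodeCov]
  push_cast
  ring

lemma covariance_Xincr_Xincr (hX : IsCenteredGaussianProcess P X (covH (1 / 6))) (n j i : ℕ) :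
    cov[Xincr X n j, Xincr X n i; P] = stepDev n * incrIncrCov j i := by
  have h : Xincr X n i = fun ω => X (dyadicPt n (i + 1)) ω - X (dyadicPt n i) ω := rfl
  rw [h, covariance_fun_sub_right (memLp_Xincr hX n j) (hX.memLp _) (hX.memLp _),
    covariance_Xincr_eval hX, covariance_Xincr_eval hX, incrIncrCov_eq]
  ring

lemma covariance_Xincr_midpt (hX : IsCenteredGaussianProcess P X (covH (1 / 6))) (n j i : ℕ) :
    cov[Xincr X n j, midpt X n i; P] =
      stepDev n * ((incrNodeCov j (i + 1) + incrNodeCov j i) / 2) := by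
  have h : midpt X n i = fun ω => (X (dyadicPt n (i + 1)) + X (dyadicPt n i)) ω / 2 := rfl
  rw [h, covariance_fun_div_right, covariance_add_right (memLp_Xincr hX n j) (hX.memLp _)
    (hX.memLp _), covariance_Xincr_eval hX, covariance_Xincr_eval hX]
  ring

lemma isGaussianSetup (hX : IsCenteredGaussianProcess P X (covH (1 / 6)))
    (hZ : ∀ t, Measurable (Z t)) (hind : IndepProcesses P X Z) (n : ℕ) (i : Fin 4 → ℕ) :
    IsGaussianSetup P (fun a => Xincr X n (i a)) (fun a => midpt X n (i a))
      (fun a => midpt Z n (i a)) where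
  gaussian := by
    classical
    refine hX.isGaussianProcess.of_isGaussianProcess fun s => ?_
    have key : ∀ s t c d, ∃ I : Finset ℝ, ∃ L : (I → ℝ) →L[ℝ] ℝ,
        ∀ ω, c * X s ω + d * X t ω = L (I.restrict (X · ω)) := fun s t c d =>
      ⟨{s, t}, c • ContinuousLinearMap.proj (R := ℝ) (φ := fun _ => ℝ) ⟨s, by simp⟩ +
        d • ContinuousLinearMap.proj (R := ℝ) (φ := fun _ => ℝ) ⟨t, by simp⟩, fun ω => by simp⟩
    rcases s with a | a
    · obtain ⟨I, L, h⟩ := key (dyadicPt n (i a + 1)) (dyadicPt n (i a)) 1 (-1)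
      exact ⟨I, L, fun ω => by rw [← h, Sum.elim_inl, Xincr]; ring⟩
    · obtain ⟨I, L, h⟩ := key (dyadicPt n (i a + 1)) (dyadicPt n (i a)) (1 / 2) (1 / 2)
      exact ⟨I, L, fun ω => by rw [← h, Sum.elim_inr, midpt]; ring⟩
  measurable s := by
    rcases s with a | a
    · exact (hX.1 _).sub (hX.1 _)
    · exact ((hX.1 _).add (hX.1 _)).div_const 2
  measurable_param a := ((hZ _).add (hZ _)).div_const 2
  mean s := by
    have hInt : ∀ t, Integrable (X t) P := fun t => (hX.memLp t).integrable (by norm_num)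
    rcases s with a | a
    · simp only [Sum.elim_inl, Xincr]
      rw [integral_sub (hInt _) (hInt _), hX.integral_eq_zero, hX.integral_eq_zero, sub_zero]
    · simp only [Sum.elim_inr, midpt]
      rw [integral_div, integral_add (hInt _) (hInt _), hX.integral_eq_zero, hX.integral_eq_zero]
      simp
  var_pos a := by
    rw [← covariance_self (memLp_Xincr hX n (i a)).aestronglyMeasurable.aemeasurable,
      covariance_Xincr_Xincr hX, incrIncrCov_self, mul_one]
    exact stepDev_pos n
  indep := by
    rw [IndepFun_iff_Indep]
    have hmeas : ∀ (Y : ℝ → Ω → ℝ) t,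
        Measurable[⨆ t : ℝ, MeasurableSpace.comap (Y t) inferInstance] (Y t) := fun Y t =>
      (comap_measurable (Y t)).mono (le_iSup (fun t => MeasurableSpace.comap (Y t) _) t) le_rfl
    refine indep_of_indep_of_le_left (indep_of_indep_of_le_right hind ?_) ?_
    · refine Measurable.comap_le (@measurable_pi_lambda _ _ _ (_) _ _ fun a => ?_)
      exact ((hmeas Z _).add (hmeas Z _)).div_const 2
    · refine Measurable.comap_le (@measurable_pi_lambda _ _ _ (_) _ _ fun s => ?_)
      rcases s with a | a
      · exact (hmeas X _).sub (hmeas X _)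
      · exact ((hmeas X _).add (hmeas X _)).div_const 2

end

lemma CbSmooth.exists_isDerivSeq {E : Type*} [NormedAddCommGroup E] [NormedSpace ℝ E]
    [MeasurableSpace E] [BorelSpace E] [SecondCountableTopology E]
    {F : Fin 4 → E → ℝ} (hF : ∀ a, CbSmooth (F a)) {v : E} (hv : ‖v‖ ≤ 1) (w : E) :
    ∃ G M, IsDerivSeq G M ∧ ∀ a x y, G a 0 x y = F a (x • v + y • w) := by
  choose K hK using fun a => (hF a).2
  have hK0 : ∀ a k, 0 ≤ K a k := fun a k => (norm_nonneg _).trans (hK a k 0)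
  refine ⟨fun a d x y => iteratedFDeriv ℝ d (F a) (x • v + y • w) fun _ => v,
    fun d => ∑ k ∈ Finset.range (d + 1), ∑ a, K a k, ⟨fun a d => ?_, fun a d x y => ?_,
    fun a d x y => ?_, fun d e hde => ?_⟩, fun a x y => by simp⟩
  · have hc : Continuous (iteratedFDeriv ℝ d (F a)) :=
      ((hF a).1 d).continuous_iteratedFDeriv le_rfl
    have h2 : Continuous fun p : ℝ × ℝ =>
        iteratedFDeriv ℝ d (F a) (p.1 • v + p.2 • w) fun _ => v :=
      ((ContinuousMultilinearMap.apply ℝ (fun _ : Fin d => E) ℝ fun _ => v).continuous.comp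
        (hc.comp (by fun_prop)))
    exact h2.measurable
  · have hd : Differentiable ℝ (iteratedFDeriv ℝ d (F a)) :=
      ((hF a).1 (d + 1)).differentiable_iteratedFDeriv (by exact_mod_cast Nat.lt_succ_self d)
    have h1 : HasDerivAt (fun x : ℝ => x • v + y • w) v x := by
      simpa using ((hasDerivAt_id x).smul_const v).add_const (y • w)
    have h2 := (hd (x • v + y • w)).hasFDerivAt.comp_hasDerivAt x h1
    have h3 := (ContinuousMultilinearMap.apply ℝ (fun _ : Fin d => E) ℝ fun _ => v).hasFDerivAt
      |>.comp_hasDerivAt x h2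
    rw [iteratedFDeriv_succ_apply_left]
    exact h3
  · rw [← Real.norm_eq_abs]
    refine (ContinuousMultilinearMap.le_opNorm _ _).trans ?_
    have h1 : ∏ _k : Fin d, ‖v‖ ≤ 1 := Finset.prod_le_one (fun _ _ => norm_nonneg _) fun _ _ => hv
    calc _ ≤ ‖iteratedFDeriv ℝ d (F a) (x • v + y • w)‖ :=
          mul_le_of_le_one_right (norm_nonneg _) h1
      _ ≤ K a d := hK a d _
      _ ≤ ∑ a, K a d :=
          Finset.single_le_sum (f := fun a => K a d) (fun a _ => hK0 a d) (Finset.mem_univ a)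
      _ ≤ _ := Finset.single_le_sum (f := fun k => ∑ a, K a k)
          (fun k _ => Finset.sum_nonneg fun a _ => hK0 a k) (Finset.self_mem_range_succ d)
  · exact Finset.sum_le_sum_of_subset_of_nonneg
      (Finset.range_subset_range.2 (by omega)) fun k _ _ => Finset.sum_nonneg fun a _ => hK0 a k

lemma sum_fin_four_fun {N : ℕ} (F : ℕ → ℕ → ℕ → ℕ → ℝ) :
    ∑ i1 ∈ Finset.range N, ∑ i2 ∈ Finset.range N, ∑ i3 ∈ Finset.range N, ∑ i4 ∈ Finset.range N,
      F i1 i2 i3 i4 = ∑ i : Fin 4 → Fin N, F (i 0) (i 1) (i 2) (i 3) := by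
  simp only [Finset.sum_range]
  rw [← (Fin.consEquiv fun _ : Fin 4 => Fin N).sum_comp, Fintype.sum_prod_type]
  refine Finset.sum_congr rfl fun i1 _ => ?_
  rw [← (Fin.consEquiv fun _ : Fin 3 => Fin N).sum_comp, Fintype.sum_prod_type]
  refine Finset.sum_congr rfl fun i2 _ => ?_
  rw [← (Fin.consEquiv fun _ : Fin 2 => Fin N).sum_comp, Fintype.sum_prod_type]
  refine Finset.sum_congr rfl fun i3 _ => ?_
  rw [← (Fin.consEquiv fun _ : Fin 1 => Fin N).sum_comp, Fintype.sum_prod_type]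
  refine Finset.sum_congr rfl fun i4 _ => ?_
  simp [Fin.consEquiv]
  rfl

lemma sum_abs_integral_prod_le {Ω : Type*} [MeasurableSpace Ω] {P : Measure Ω}
    [IsProbabilityMeasure P] {X Z : ℝ → Ω → ℝ}
    (hX : IsCenteredGaussianProcess P X (covH (1 / 6)))
    (hZ : ∀ t, Measurable (Z t)) (hind : IndepProcesses P X Z)
    {G : Fin 4 → ℕ → ℝ → ℝ → ℝ} {M : ℕ → ℝ} (hG : IsDerivSeq G M) (n N : ℕ) :
    ∑ i : Fin 4 → Fin N, |∫ ω, ∏ a, (G a 0 (midpt X n (i a) ω) (midpt Z n (i a) ω) *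
        (Xincr X n (i a) ω ^ 3 - 3 * stepDev n ^ 2 * Xincr X n (i a) ω)) ∂P| ≤
      16 * 81 * 16 ^ 12 * M 12 ^ 4 * 1024 *
        (N * stepDev n ^ 3 * (3 + 2 * (stepDev n * absCbrt N))) ^ 2 := by
  set ε := stepDev n with hε
  have hε0 : 0 < ε := stepDev_pos n
  let α : Fin N → Fin N → ℝ := fun j j' => ε * |(incrNodeCov j (j' + 1) + incrNodeCov j j') / 2|
  let γ : Fin N → Fin N → ℝ := fun j j' => ε * |incrIncrCov j j'|
  set A := ε ^ 3 * (3 + 2 * (ε * absCbrt N)) with hA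
  have hN := absCbrt_nonneg N
  have hα0 : ∀ j j', 0 ≤ α j j' := fun j j' => by positivity
  have hγ0 : ∀ j j', 0 ≤ γ j j' := fun j j' => by positivity
  have hαε : ∀ j j', α j j' ≤ ε := fun j j' => by
    refine mul_le_of_le_one_right hε0.le ?_
    have h1 := abs_le.1 (abs_incrNodeCov_le j (j' + 1))
    have h2 := abs_le.1 (abs_incrNodeCov_le j j')
    exact abs_le.2 ⟨by linarith [h1.1, h2.1], by linarith [h1.2, h2.2]⟩
  have hγε : ∀ j j', γ j j' ≤ ε := fun j j' =>
    mul_le_of_le_one_right hε0.le (abs_incrIncrCov_le j j')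
  have hsmall : ε ^ 3 * (ε * (3 / 2 * absCbrt N)) ≤ A := by
    rw [hA]
    gcongr
    nlinarith [mul_nonneg hε0.le hN]
  have hsα : ∀ j', ∑ j, ε ^ 3 * α j j' ≤ A := fun j' => by
    refine le_trans ?_ hsmall
    simp only [α, ← Finset.mul_sum]
    gcongr
    rw [← Finset.sum_range (f := fun j => |(incrNodeCov j (j' + 1) + incrNodeCov j j') / 2|)]
    have h1 := sum_abs_incrNodeCov_le (N := N) (i := j' + 1) (by omega)
    have h2 := sum_abs_incrNodeCov_le (N := N) (i := j') (by omega)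
    calc _ ≤ ∑ j ∈ Finset.range N, (|incrNodeCov j (j' + 1)| + |incrNodeCov j j'|) / 2 :=
          Finset.sum_le_sum fun j _ => by
            rw [abs_div, abs_two]
            gcongr
            exact abs_add_le _ _
      _ ≤ _ := by
          rw [← Finset.sum_div, Finset.sum_add_distrib]
          linarith
  have hsα' : ∑ j, ε ^ 3 * α j j ≤ A := by
    refine le_trans ?_ hsmall
    simp only [α, ← Finset.mul_sum]
    gcongr
    rw [← Finset.sum_range (f := fun j => |(incrNodeCov j (j + 1) + incrNodeCov j j) / 2|)]
    exact sum_abs_incrNodeCov_self_le N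
  have hsγ : ∀ j', ∑ j, ε ^ 2 * γ j j' ≤ A := fun j' => by
    simp only [γ, ← Finset.mul_sum]
    rw [← Finset.sum_range (f := fun j => |incrIncrCov j j'|)]
    calc _ ≤ ε ^ 2 * (ε * 3) := by
          gcongr
          exact sum_abs_incrIncrCov_le N j'
      _ = ε ^ 3 * (3 + 0) := by ring
      _ ≤ A := by
          rw [hA]
          gcongr
          positivity
  have hmain : ∀ i : Fin 4 → Fin N,
      |∫ ω, ∏ a, (G a 0 (midpt X n (i a) ω) (midpt Z n (i a) ω) *
        (Xincr X n (i a) ω ^ 3 - 3 * ε ^ 2 * Xincr X n (i a) ω)) ∂P| ≤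
      16 * (81 * (16 ^ 12 * (M 12 ^ 4 * Contraction.admissibleSum α γ ε i))) := fun i =>
    abs_integral_prod_mul_cube_sub_le (isGaussianSetup hX hZ hind n fun a => i a) hG
      (fun u v => by
        rw [covariance_Xincr_midpt hX, abs_mul, abs_of_pos hε0])
      (fun u v => by
        rw [covariance_Xincr_Xincr hX, abs_mul, abs_of_pos hε0])
      hα0 hγ0 hαε hγε (stepDev_le_one n)
  have hsum := Contraction.sum_admissibleSum_le hε0.le hα0 hγ0
    (fun j j' => by simp only [γ]; rw [incrIncrCov_symm]) hsα hsα' hsγ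
  rw [Fintype.card_fin] at hsum
  refine (Finset.sum_le_sum fun i _ => hmain i).trans ?_
  simp only [← Finset.mul_sum]
  calc _ ≤ 16 * (81 * (16 ^ 12 * (M 12 ^ 4 * (1024 * (A ^ 2 * N ^ 2))))) := by
        gcongr
    _ = _ := by
        rw [hA]
        ring

lemma sq_nSteps_mul_le (n : ℕ) {t : ℝ} (ht : 0 ≤ t) :
    (nSteps n t * stepDev n ^ 3 * (3 + 2 * (stepDev n * absCbrt (nSteps n t)))) ^ 2 ≤
      25 * (t + t ^ 2 + t ^ 3 + t ^ 4) := by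
  have hε := stepDev_pos n
  have hτ : nSteps n t * stepDev n ^ 3 ≤ t := by
    have h := Nat.floor_le (show 0 ≤ (2 : ℝ) ^ ((n : ℝ) / 2) * t by positivity)
    calc _ ≤ (2 : ℝ) ^ ((n : ℝ) / 2) * t * stepDev n ^ 3 := by
          gcongr
          exact h
      _ = ((2 : ℝ) ^ ((n : ℝ) / 2) * (2 : ℝ) ^ (-(n : ℝ) / 2)) * t := by
          rw [stepDev_pow_three]
          ring
      _ = t := by
          rw [← Real.rpow_add two_pos]
          ring_nf
          simp
  have hτ0 : 0 ≤ (nSteps n t : ℝ) * stepDev n ^ 3 := by positivity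
  have hs : stepDev n * absCbrt (nSteps n t) = absCbrt (nSteps n t * stepDev n ^ 3) := by
    rw [absCbrt_mul, absCbrt_pow_three hε.le, mul_comm]
  rw [hs]
  set τ := (nSteps n t : ℝ) * stepDev n ^ 3
  have hc0 := absCbrt_nonneg τ
  have hc : absCbrt τ ≤ 1 + τ := by
    have h3 := pow_three_absCbrt hτ0
    nlinarith [sq_nonneg (absCbrt τ - 1), mul_nonneg hc0 (sq_nonneg (absCbrt τ - 1))]
  calc (τ * (3 + 2 * absCbrt τ)) ^ 2 ≤ (t * (3 + 2 * (1 + t))) ^ 2 := by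
        gcongr
        linarith
    _ ≤ 25 * (t + t ^ 2 + t ^ 3 + t ^ 4) := by
        nlinarith [pow_nonneg ht 2, pow_nonneg ht 3, pow_nonneg ht 4]

lemma exists_sum_abs_integral_le {Ω : Type*} [MeasurableSpace Ω] {P : Measure Ω}
    [IsProbabilityMeasure P] {X Z : ℝ → Ω → ℝ}
    (hX : IsCenteredGaussianProcess P X (covH (1 / 6)))
    (hZ : ∀ t, Measurable (Z t)) (hind : IndepProcesses P X Z)
    {F : Fin 4 → ℝ × ℝ → ℝ} (hF : ∀ a, CbSmooth (F a)) {v : ℝ × ℝ} (hv : ‖v‖ ≤ 1) (w : ℝ × ℝ) :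
    ∃ C : ℝ, 0 < C ∧ ∀ t : ℝ, 0 ≤ t → ∀ n : ℕ,
      ∑ i : Fin 4 → Fin (nSteps n t),
        |∫ ω, ∏ a, (F a (midpt X n (i a) ω • v + midpt Z n (i a) ω • w) *
          (Xincr X n (i a) ω ^ 3 - 3 * (2 : ℝ) ^ (-(n : ℝ) / 3) * Xincr X n (i a) ω)) ∂P| ≤
        C * (t + t ^ 2 + t ^ 3 + t ^ 4) := by
  obtain ⟨G, M, hG, hG0⟩ := CbSmooth.exists_isDerivSeq hF hv w
  have hM := pow_nonneg (hG.nonneg 12) 4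
  refine ⟨16 * 81 * 16 ^ 12 * M 12 ^ 4 * 1024 * 25 + 1, by positivity, fun t ht n => ?_⟩
  have h := sum_abs_integral_prod_le hX hZ hind hG n (nSteps n t)
  simp only [hG0, stepDev_sq] at h
  refine h.trans ?_
  calc _ ≤ 16 * 81 * 16 ^ 12 * M 12 ^ 4 * 1024 * (25 * (t + t ^ 2 + t ^ 3 + t ^ 4)) := by
        gcongr
        exact sq_nSteps_mul_le n ht
    _ ≤ _ := by
        rw [← mul_assoc]
        gcongr
        linarith

theorem third_chaos_moment_bound_full_sum
    {Ω : Type*} [MeasurableSpace Ω] (P : Measure Ω) [IsProbabilityMeasure P]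
    (X1 X2 : ℝ → Ω → ℝ)
    (hX1 : IsCenteredGaussianProcess P X1 (covH (1 / 6)))
    (hX2 : IsCenteredGaussianProcess P X2 (covH (1 / 6)))
    (hInd : IndepProcesses P X1 X2)
    (f1 f2 f3 f4 : ℝ → ℝ → ℝ)
    (hf1 : CbSmooth2 f1) (hf2 : CbSmooth2 f2) (hf3 : CbSmooth2 f3) (hf4 : CbSmooth2 f4) :
    ∀ Y : ℝ → Ω → ℝ, Y = X1 ∨ Y = X2 →
      ∃ C : ℝ, 0 < C ∧ ∀ t : ℝ, 0 ≤ t → ∀ n : ℕ, 1 ≤ n →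
        (∑ i1 ∈ Finset.range (nSteps n t), ∑ i2 ∈ Finset.range (nSteps n t),
          ∑ i3 ∈ Finset.range (nSteps n t), ∑ i4 ∈ Finset.range (nSteps n t),
            abs (∫ ω,
              ((Xmid X1 X2 f1 n i1 ω *
                  (Xincr Y n i1 ω ^ 3 - 3 * (2 : ℝ) ^ (-(n : ℝ) / 3) * Xincr Y n i1 ω)) *
                (Xmid X1 X2 f2 n i2 ω *
                  (Xincr Y n i2 ω ^ 3 - 3 * (2 : ℝ) ^ (-(n : ℝ) / 3) * Xincr Y n i2 ω)) *
                (Xmid X1 X2 f3 n i3 ω *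
                  (Xincr Y n i3 ω ^ 3 - 3 * (2 : ℝ) ^ (-(n : ℝ) / 3) * Xincr Y n i3 ω)) *
                (Xmid X1 X2 f4 n i4 ω *
                  (Xincr Y n i4 ω ^ 3 - 3 * (2 : ℝ) ^ (-(n : ℝ) / 3) * Xincr Y n i4 ω))) ∂P)) ≤
          C * (t + t ^ 2 + t ^ 3 + t ^ 4) := by
  intro Y hY
  let F : Fin 4 → ℝ × ℝ → ℝ := ![fun p => f1 p.1 p.2, fun p => f2 p.1 p.2, fun p => f3 p.1 p.2,
    fun p => f4 p.1 p.2]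
  have hF : ∀ a, CbSmooth (F a) := by
    intro a
    fin_cases a
    exacts [hf1, hf2, hf3, hf4]
  rcases hY with rfl | rfl
  · obtain ⟨C, hC, h⟩ := exists_sum_abs_integral_le hX1 hX2.1 hInd hF
      (v := (1, 0)) (by simp [Prod.norm_def]) (0, 1)
    refine ⟨C, hC, fun t ht n _ => (Eq.le ?_).trans (h t ht n)⟩
    rw [sum_fin_four_fun fun i1 i2 i3 i4 => |∫ ω, (_ : ℝ) ∂P|]
    simp [Fin.prod_univ_four, F, Xmid, midpt]
  · obtain ⟨C, hC, h⟩ := exists_sum_abs_integral_le hX2 hX1.1 hInd.symm hF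
      (v := (0, 1)) (by simp [Prod.norm_def]) (1, 0)
    refine ⟨C, hC, fun t ht n _ => (Eq.le ?_).trans (h t ht n)⟩
    rw [sum_fin_four_fun fun i1 i2 i3 i4 => |∫ ω, (_ : ℝ) ∂P|]
    simp [Fin.prod_univ_four, F, Xmid, midpt]

end
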